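/- arXiv:2403.12713 — 10 statements merged into one kernel-verified Lean document; each statement's English description precedes it below -/
import Mathlib

section
/- Let 𝒢 be an n-vertex k-uniform hypergraph. Then 𝒢 has a spanning Euler tour if any of the following holds: (i) k = 3, n ≥ 7, and δ₂(𝒢) ≥ 3; (ii) k ≥ 4 and either (δ₂(𝒢) ≥ k and n ≥ C(k,2)+1) or (δ₃(𝒢) ≥ 1 and n ≥ k²−3k+5); (iii) k ≥ 5, n ≥ C(k,2)+1, and δ_r(𝒢) ≥ 1 for some r with 4 ≤ r ≤ k. -/
open Finset

/-- A closed walk in a hypergraph with vertex type `V` whose edges are indexed by `ι`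
(the edge with index `i` is the finset `E i`; multiple edges are allowed, corresponding
to indices with equal edge sets).  It is an alternating cyclic sequence
`v_1, e_1, v_2, e_2, …, v_t, e_t` with `{v_i, v_{i+1}} ⊆ e_i` and `v_i ≠ v_{i+1}`,
indices taken modulo `t`. -/
structure ClosedWalk {V ι : Type*} (E : ι → Finset V) where
  len : ℕ
  len_pos : 0 < len
  vtx : ZMod len → V
  edg : ZMod len → ι
  mem_self : ∀ i, vtx i ∈ E (edg i)
  mem_succ : ∀ i, vtx (i + 1) ∈ E (edg i)
  vtx_ne : ∀ i, vtx i ≠ vtx (i + 1)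

/-- An Euler tour is a closed walk traversing each edge exactly once. -/
def IsEulerTour {V ι : Type*} (E : ι → Finset V) (W : ClosedWalk E) : Prop :=
  ∀ e : ι, ∃! i : ZMod W.len, W.edg i = e

/-- A closed walk is spanning if it traverses every vertex. -/
def IsSpanningWalk {V ι : Type*} (E : ι → Finset V) (W : ClosedWalk E) : Prop :=
  ∀ v : V, ∃ i : ZMod W.len, W.vtx i = v

/-- The hypergraph has a spanning Euler tour: a closed walk traversing each edge
exactly once and visiting every vertex. -/
def HasSpanningEulerTour {V ι : Type*} (E : ι → Finset V) : Prop :=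
  ∃ W : ClosedWalk E, IsEulerTour E W ∧ IsSpanningWalk E W

/-- An Euler family: a (finite) family of closed walks such that every edge is
traversed exactly once, by exactly one walk of the family.  A hypergraph having an
Euler family is called quasi-Eulerian. -/
def HasEulerFamily {V ι : Type*} (E : ι → Finset V) : Prop :=
  ∃ (m : ℕ) (W : Fin m → ClosedWalk E),
    ∀ e : ι, ∃! p : (j : Fin m) × ZMod (W j).len, (W p.1).edg p.2 = e

/-- Connectivity of a hypergraph: every two vertices are joined by a walk, i.e. they
are related by the reflexive-transitive closure of "lying in a common edge". -/
def HConnected {V ι : Type*} (E : ι → Finset V) : Prop :=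
  ∀ u v : V, Relation.ReflTransGen (fun a b => ∃ i, a ∈ E i ∧ b ∈ E i) u v

open Module Submodule Classical in
/-- **Rado's theorem** for linear matroids, spanning version: if every subspace `U` of `W`
fails to contain at least `codim U` of the finite sets `S i`, then one can choose a vector
in each `S i` such that the chosen vectors span `W`. -/
theorem exists_spanning_transversal {ι K M : Type*} [Fintype ι] [Field K] [AddCommGroup M]
    [Module K M] [FiniteDimensional K M] (W : Submodule K M) (S : ι → Finset M)
    (hne : ∀ i, (S i).Nonempty) (hSW : ∀ i, ∀ a ∈ S i, a ∈ W)
    (hS : ∀ U ≤ W, finrank K W ≤ finrank K U +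
      (Finset.univ.filter (fun i => ¬ ∀ a ∈ S i, a ∈ U)).card) :
    ∃ v : ι → M, (∀ i, v i ∈ S i) ∧ W ≤ span K (Set.range v) := by
  induction hm : ∑ i, (S i).card using Nat.strong_induction_on generalizing S with
  | _ m ih =>
  by_cases hcard : ∀ i, (S i).card ≤ 1
  · choose v hv using hne
    have hUW : span K (Set.range v) ≤ W := by
      rw [span_le]
      rintro _ ⟨i, rfl⟩
      exact hSW i _ (hv i)
    refine ⟨v, hv, ?_⟩
    have h := hS _ hUW
    rw [Finset.filter_false_of_mem, Finset.card_empty, add_zero] at h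
    · exact (eq_of_le_of_finrank_le hUW h).ge
    · intro i _
      push Not
      intro a ha
      rw [Finset.card_le_one.1 (hcard i) a ha _ (hv i)]
      exact subset_span ⟨i, rfl⟩
  push Not at hcard
  obtain ⟨e, he⟩ := hcard
  obtain ⟨a, ha⟩ := hne e
  have step : ∀ R : Finset M, R.Nonempty → R ⊂ S e →
      (∀ U ≤ W, finrank K W ≤ finrank K U +
        (Finset.univ.filter (fun i => ¬ ∀ a ∈ Function.update S e R i, a ∈ U)).card) →
      ∃ v : ι → M, (∀ i, v i ∈ S i) ∧ W ≤ span K (Set.range v) := by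
    intro R hR hRe hU
    have hsub : ∀ i, Function.update S e R i ⊆ S i := by
      intro i
      by_cases hi : i = e
      · subst hi
        simpa using hRe.1
      · simp [hi]
    have hsum : ∑ i, (Function.update S e R i).card < m := by
      rw [← hm]
      refine Finset.sum_lt_sum (fun i _ => Finset.card_le_card (hsub i))
        ⟨e, Finset.mem_univ _, ?_⟩
      simpa using Finset.card_lt_card hRe
    have hne' : ∀ i, (Function.update S e R i).Nonempty := by
      intro i
      by_cases hi : i = e
      · subst hi
        simpa using hR
      · simpa [hi] using hne i
    obtain ⟨v, hv, hvW⟩ := ih _ hsum _ hne' (fun i b hb => hSW i b (hsub i hb)) hU rfl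
    exact ⟨v, fun i => hsub i (hv i), hvW⟩
  by_contra hcon
  have fail : ∀ R : Finset M, R.Nonempty → R ⊂ S e → ∃ U ≤ W, (∀ b ∈ R, b ∈ U) ∧
      finrank K U + ((Finset.univ.erase e).filter (fun i => ¬ ∀ a ∈ S i, a ∈ U)).card + 1
        ≤ finrank K W := by
    intro R hR hRe
    by_contra hno
    refine hcon (step R hR hRe fun U hU => ?_)
    have hcongr : (Finset.univ.erase e).filter
        (fun i => ¬ ∀ a ∈ Function.update S e R i, a ∈ U) =
        (Finset.univ.erase e).filter (fun i => ¬ ∀ a ∈ S i, a ∈ U) := by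
      refine Finset.filter_congr fun i hi => ?_
      rw [Function.update_of_ne (Finset.ne_of_mem_erase hi)]
    have hUS := hS U hU
    rw [← Finset.insert_erase (Finset.mem_univ e), Finset.filter_insert] at hUS ⊢
    rw [hcongr, Function.update_self]
    by_cases hRU : ∀ b ∈ R, b ∈ U
    · have : ¬ finrank K U + ((Finset.univ.erase e).filter
        (fun i => ¬ ∀ a ∈ S i, a ∈ U)).card + 1 ≤ finrank K W :=
        fun h => hno ⟨U, hU, hRU, h⟩
      rw [if_neg (not_not.2 hRU)]
      omega
    · rw [if_pos fun h => hRU fun b hb => h b (hRe.1 hb)] at hUS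
      rwa [if_pos hRU]
  obtain ⟨U, hUW, haU, hU⟩ := fail {a} (Finset.singleton_nonempty a) (by
    refine (Finset.singleton_subset_iff.2 ha).ssubset_of_ne fun h => ?_
    rw [← h] at he
    simp at he)
  obtain ⟨U', hUW', haU', hU'⟩ := fail ((S e).erase a)
    (by rw [← Finset.card_pos, Finset.card_erase_of_mem ha]; omega) (Finset.erase_ssubset ha)
  have hsup := hS (U ⊔ U') (sup_le hUW hUW')
  have hinf := hS (U ⊓ U') (inf_le_left.trans hUW)
  have hmod := finrank_sup_add_finrank_inf_eq U U'
  rw [← Finset.insert_erase (Finset.mem_univ e), Finset.filter_insert] at hsup hinf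
  rw [if_neg (not_not.2 fun b hb => ?_)] at hsup
  swap
  · by_cases hba : b = a
    · exact mem_sup_left (haU b (by simp [hba]))
    · exact mem_sup_right (haU' b (Finset.mem_erase.2 ⟨hba, hb⟩))
  have hinf' : finrank K W ≤ finrank K (U ⊓ U' : Submodule K M) +
      ((Finset.univ.erase e).filter (fun i => ¬ ∀ a ∈ S i, a ∈ U ⊓ U')).card + 1 := by
    refine hinf.trans ?_
    split_ifs
    · exact (Nat.le_succ _)
    · rw [Finset.card_insert_of_notMem (by simp), add_assoc]
  have hcount : ((Finset.univ.erase e).filter (fun i => ¬ ∀ a ∈ S i, a ∈ U ⊔ U')).card +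
      ((Finset.univ.erase e).filter (fun i => ¬ ∀ a ∈ S i, a ∈ U ⊓ U')).card ≤
      ((Finset.univ.erase e).filter (fun i => ¬ ∀ a ∈ S i, a ∈ U)).card +
      ((Finset.univ.erase e).filter (fun i => ¬ ∀ a ∈ S i, a ∈ U')).card := by
    simp only [Finset.card_filter, ← Finset.sum_add_distrib]
    refine Finset.sum_le_sum fun i _ => ?_
    have h1 : (∀ b ∈ S i, b ∈ U) → ∀ b ∈ S i, b ∈ U ⊔ U' := fun h b hb => mem_sup_left (h b hb)
    have h2 : (∀ b ∈ S i, b ∈ U') → ∀ b ∈ S i, b ∈ U ⊔ U' :=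
      fun h b hb => mem_sup_right (h b hb)
    have h3 : (∀ b ∈ S i, b ∈ U) → (∀ b ∈ S i, b ∈ U') → ∀ b ∈ S i, b ∈ U ⊓ U' :=
      fun h h' b hb => ⟨h b hb, h' b hb⟩
    by_cases p : ∀ b ∈ S i, b ∈ U <;> by_cases q : ∀ b ∈ S i, b ∈ U'
    · rw [if_neg (not_not.2 (h1 p)), if_neg (not_not.2 (h3 p q))]; simp
    · rw [if_neg (not_not.2 (h1 p)), if_pos q]; split_ifs <;> simp
    · rw [if_neg (not_not.2 (h2 q)), if_pos p]; split_ifs <;> simp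
    · rw [if_pos p, if_pos q]; split_ifs <;> simp
  omega

/-- The characteristic vector over `ZMod 2` of an edge with endpoints `x` and `y`. -/
def edgeVec {V : Type*} [DecidableEq V] (x y : V) : V → ZMod 2 :=
  Pi.single x 1 + Pi.single y 1

theorem edgeVec_self {V : Type*} [DecidableEq V] (x : V) : edgeVec x x = 0 :=
  funext fun _ => CharTwo.add_self_eq_zero _

theorem edgeVec_comm {V : Type*} [DecidableEq V] (x y : V) : edgeVec x y = edgeVec y x :=
  add_comm _ _

theorem edgeVec_add_edgeVec {V : Type*} [DecidableEq V] (x y z : V) :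
    edgeVec x y + edgeVec y z = edgeVec x z := by
  have h : (Pi.single y 1 + Pi.single y 1 : V → ZMod 2) = 0 := edgeVec_self y
  unfold edgeVec
  linear_combination (exp := 1) h

/-- A trail from `u` to `w` traversing the list `l` of edges of the multigraph in which
the edge `e` has endpoints `s e` and `t e`. -/
inductive Trail {V ι : Type*} (s t : ι → V) : V → List ι → V → Prop
  | nil (u : V) : Trail s t u [] u
  | cons {e : ι} {u v w : V} {l : List ι} (h : (s e = u ∧ t e = v) ∨ (s e = v ∧ t e = u))
      (hl : Trail s t v l w) : Trail s t u (e :: l) w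

namespace Trail

variable {V ι : Type*} {s t : ι → V}

theorem append {u v w : V} {l l' : List ι} (h : Trail s t u l v) (h' : Trail s t v l' w) :
    Trail s t u (l ++ l') w := by
  induction h with
  | nil => exact h'
  | cons he _ ih => exact .cons he (ih h')

theorem exists_of_append {u w : V} {l l' : List ι} (h : Trail s t u (l ++ l') w) :
    ∃ v, Trail s t u l v ∧ Trail s t v l' w := by
  induction l generalizing u with
  | nil => exact ⟨u, .nil u, h⟩
  | cons e l ih =>
    cases h with
    | cons he hl =>
      obtain ⟨v, h1, h2⟩ := ih hl
      exact ⟨v, .cons he h1, h2⟩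

theorem sum_edgeVec [DecidableEq V] {u w : V} {l : List ι} (h : Trail s t u l w) :
    (l.map fun e => edgeVec (s e) (t e)).sum = edgeVec u w := by
  induction h with
  | nil u => simp [edgeVec_self]
  | @cons e u v w l he _ ih =>
    rw [List.map_cons, List.sum_cons, ih]
    rcases he with ⟨rfl, rfl⟩ | ⟨rfl, rfl⟩
    · exact edgeVec_add_edgeVec _ _ _
    · rw [edgeVec_comm (s e), edgeVec_add_edgeVec]

theorem exists_vertices {u w : V} {l : List ι} (h : Trail s t u l w) :
    ∃ p : ℕ → V, p 0 = u ∧ p l.length = w ∧ ∀ (j : ℕ) (hj : j < l.length),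
      (s l[j] = p j ∧ t l[j] = p (j + 1)) ∨ (s l[j] = p (j + 1) ∧ t l[j] = p j) := by
  induction h with
  | nil u => exact ⟨fun _ => u, rfl, rfl, by simp⟩
  | @cons e u v w l he _ ih =>
    obtain ⟨p, h0, h1, h2⟩ := ih
    refine ⟨fun j => Nat.casesOn j u p, rfl, h1, fun j hj => ?_⟩
    cases j with
    | zero => simpa [h0] using he
    | succ j => exact h2 j (by simpa using hj)

end Trail

/-- **Euler's theorem** for multigraphs: a connected multigraph with at least one edge in
which all degrees are even has a closed trail traversing every edge. -/
theorem exists_euler_trail {V ι : Type*} [DecidableEq V] [Fintype ι] [Nonempty ι]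
    (s t : ι → V) (heven : ∑ e, edgeVec (s e) (t e) = 0)
    (hconn : ∀ S : Set V, S.Nonempty → (∀ e, s e ∈ S ↔ t e ∈ S) → S = Set.univ) :
    ∃ u l, Trail s t u l u ∧ l.Nodup ∧ ∀ e, e ∈ l := by
  classical
  have hex : ∃ n, ∃ u l w, Trail s t u l w ∧ l.Nodup ∧ l.length = n :=
    ⟨0, s (Classical.arbitrary ι), [], _, .nil _, List.nodup_nil, rfl⟩
  have hbd : ∀ n, (∃ u l w, Trail s t u l w ∧ l.Nodup ∧ l.length = n) → n ≤ Fintype.card ι := by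
    rintro n ⟨u, l, w, -, hl, rfl⟩
    exact hl.length_le_card
  obtain ⟨n, ⟨u, l, w, hT, hl, hn⟩, hmax⟩ : ∃ n, (∃ u l w, Trail s t u l w ∧ l.Nodup ∧
      l.length = n) ∧ ∀ u l w, Trail s t u l w → l.Nodup → l.length ≤ n := by
    obtain ⟨N, hN⟩ := hex
    exact ⟨_, Nat.findGreatest_spec (P := fun n => ∃ u l w, Trail s t u l w ∧ l.Nodup ∧
      l.length = n) (hbd N hN) hN,
      fun u l w h1 h2 => Nat.le_findGreatest h2.length_le_card ⟨u, l, w, h1, h2, rfl⟩⟩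
  have hext : ∀ {u l w e}, Trail s t u l w → l.Nodup → l.length = n → (s e = u ∨ t e = u) →
      e ∈ l := by
    intro u l w e hT hl hn he
    by_contra hel
    have h : ∃ v, Trail s t v (e :: l) w := by
      rcases he with he | he
      · exact ⟨t e, .cons (.inr ⟨he, rfl⟩) hT⟩
      · exact ⟨s e, .cons (.inl ⟨rfl, he⟩) hT⟩
    obtain ⟨v, hv⟩ := h
    have := hmax _ _ _ hv (List.nodup_cons.2 ⟨hel, hl⟩)
    simp at this
    omega
  have huw : u = w := by
    by_contra huw
    have h1 : ∑ e, edgeVec (s e) (t e) u = 0 := by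
      rw [← Finset.sum_apply, heven, Pi.zero_apply]
    have h2 : ∑ e ∈ l.toFinset, edgeVec (s e) (t e) u = ∑ e, edgeVec (s e) (t e) u := by
      refine Finset.sum_subset (Finset.subset_univ _) fun e _ he => ?_
      have he' : ¬ (s e = u ∨ t e = u) := fun h => he (List.mem_toFinset.2 (hext hT hl hn h))
      push Not at he'
      simp [edgeVec, he'.1.symm, he'.2.symm]
    rw [h1, ← Finset.sum_apply, List.sum_toFinset _ hl, hT.sum_edgeVec] at h2
    simp [edgeVec, huw] at h2
  subst huw
  have hmem : ∀ {x l₁ l₂ e}, l = l₁ ++ l₂ → Trail s t u l₁ x → Trail s t x l₂ u →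
      (s e = x ∨ t e = x) → e ∈ l := by
    rintro x l₁ l₂ e rfl h1 h2 he
    have := hext (h2.append h1) (List.perm_append_comm.nodup hl)
      (by rw [← hn]; simp [add_comm]) he
    simpa [or_comm] using this
  have hS := hconn {x | ∃ l₁ l₂, l = l₁ ++ l₂ ∧ Trail s t u l₁ x ∧ Trail s t x l₂ u}
    ⟨u, [], l, rfl, .nil u, hT⟩ (by
    have key : ∀ e ∈ l, (∃ l₁ l₂, l = l₁ ++ l₂ ∧ Trail s t u l₁ (s e) ∧ Trail s t (s e) l₂ u) ∧
        ∃ l₁ l₂, l = l₁ ++ l₂ ∧ Trail s t u l₁ (t e) ∧ Trail s t (t e) l₂ u := by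
      intro e he
      obtain ⟨l₁, l₂, rfl⟩ := List.append_of_mem he
      obtain ⟨p, hp, hp'⟩ := hT.exists_of_append
      cases hp' with
      | @cons _ _ q _ _ hpq hq =>
        have hA : ∃ m₁ m₂, l₁ ++ e :: l₂ = m₁ ++ m₂ ∧ Trail s t u m₁ p ∧ Trail s t p m₂ u :=
          ⟨l₁, e :: l₂, rfl, hp, .cons hpq hq⟩
        have hB : ∃ m₁ m₂, l₁ ++ e :: l₂ = m₁ ++ m₂ ∧ Trail s t u m₁ q ∧ Trail s t q m₂ u :=
          ⟨l₁ ++ [e], l₂, by simp, hp.append (.cons hpq (.nil q)), hq⟩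
        rcases hpq with ⟨h, h'⟩ | ⟨h, h'⟩
        · rw [h, h']; exact ⟨hA, hB⟩
        · rw [h, h']; exact ⟨hB, hA⟩
    intro e
    constructor
    · rintro ⟨l₁, l₂, h, h1, h2⟩
      exact (key e (hmem h h1 h2 (.inl rfl))).2
    · rintro ⟨l₁, l₂, h, h1, h2⟩
      exact (key e (hmem h h1 h2 (.inr rfl))).1)
  rw [Set.eq_univ_iff_forall] at hS
  refine ⟨u, l, hT, hl, fun e => ?_⟩
  obtain ⟨l₁, l₂, h, h1, h2⟩ := hS (s e)
  exact hmem h h1 h2 (.inl rfl)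

/-- If one can choose two distinct vertices in each edge of a hypergraph so that the
resulting multigraph is connected with all degrees even, then the hypergraph has a spanning
Euler tour. -/
theorem hasSpanningEulerTour_of_endpoints {V ι : Type*} [DecidableEq V] [Fintype ι] [Nonempty ι]
    (E : ι → Finset V) (s t : ι → V) (hs : ∀ e, s e ∈ E e) (ht : ∀ e, t e ∈ E e)
    (hst : ∀ e, s e ≠ t e) (heven : ∑ e, edgeVec (s e) (t e) = 0)
    (hconn : ∀ S : Set V, S.Nonempty → (∀ e, s e ∈ S ↔ t e ∈ S) → S = Set.univ) :
    HasSpanningEulerTour E := by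
  obtain ⟨u, l, hT, hl, hall⟩ := exists_euler_trail s t heven hconn
  obtain ⟨p, hp0, hp1, hp⟩ := hT.exists_vertices
  obtain ⟨n, hn⟩ : ∃ n, l.length = n + 1 := by
    refine Nat.exists_eq_succ_of_ne_zero fun h => ?_
    have := hall (Classical.arbitrary ι)
    rw [List.length_eq_zero_iff.1 h] at this
    simp at this
  have hlt : ∀ i : ZMod (n + 1), i.val < l.length := fun i => by
    rw [hn]
    exact ZMod.val_lt i
  have hstep : ∀ i : ZMod (n + 1), p (i + 1).val = p (i.val + 1) := by
    intro i
    by_cases h : i.val = n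
    · have hi : i + 1 = 0 := by
        rw [← ZMod.natCast_zmod_val i, h]
        exact_mod_cast ZMod.natCast_self (n + 1)
      rw [hi, ZMod.val_zero, hp0, h, ← hn, hp1]
    · have hi : i + 1 = ((i.val + 1 : ℕ) : ZMod (n + 1)) := by simp
      have := ZMod.val_lt i
      rw [hi, ZMod.val_cast_of_lt (by omega)]
  refine ⟨⟨n + 1, n.succ_pos, fun i => p i.val, fun i => l[i.val]'(hlt i), ?_, ?_, ?_⟩, ?_, ?_⟩
  · intro i
    rcases hp _ (hlt i) with h | h
    · exact h.1 ▸ hs _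
    · exact h.2 ▸ ht _
  · intro i
    rw [hstep]
    rcases hp _ (hlt i) with h | h
    · exact h.2 ▸ ht _
    · exact h.1 ▸ hs _
  · intro i
    rw [hstep]
    rcases hp _ (hlt i) with h | h
    · rw [← h.1, ← h.2]; exact hst _
    · rw [← h.1, ← h.2]; exact (hst _).symm
  · intro e
    obtain ⟨j, hj, rfl⟩ := List.getElem_of_mem (hall e)
    refine ⟨(j : ZMod (n + 1)), ?_, fun i hi => ?_⟩
    · simp [ZMod.val_cast_of_lt (hn ▸ hj)]
    · rw [← (hl.getElem_inj_iff (hi := hlt i)).1 hi]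
      simp
  · intro x
    have hx : ∃ e, s e = x ∨ t e = x := by
      by_contra! hx
      have h := hconn {x} ⟨x, rfl⟩ fun e => by simp [hx e]
      exact (hx (Classical.arbitrary ι)).1 (h.ge (Set.mem_univ _))
    obtain ⟨e, he⟩ := hx
    obtain ⟨j, hj, rfl⟩ := List.getElem_of_mem (hall e)
    have hj' : ((j : ZMod (n + 1))).val = j := ZMod.val_cast_of_lt (hn ▸ hj)
    have hxj : x = p j ∨ x = p (j + 1) := by
      rcases hp j hj with h | h <;> rw [h.1, h.2] at he <;> tauto
    rcases hxj with rfl | rfl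
    · exact ⟨j, congrArg p hj'⟩
    · exact ⟨j + 1, by rw [← hj']; simpa [hj'] using hstep j⟩

open Submodule in
/-- If the characteristic vectors of the edges of a multigraph span those of all pairs of
vertices, then the multigraph is connected. -/
theorem eq_univ_of_edgeVec_mem_span {V ι : Type*} [Fintype V] [DecidableEq V]
    (w : ι → V → ZMod 2) (hw : ∀ x y, edgeVec x y ∈ span (ZMod 2) (Set.range w))
    (S : Set V) (hS : S.Nonempty)
    (hclosed : ∀ i, w i = 0 ∨ ∃ x y, w i = edgeVec x y ∧ (x ∈ S ↔ y ∈ S)) :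
    S = Set.univ := by
  classical
  obtain ⟨x, hx⟩ := hS
  rw [Set.eq_univ_iff_forall]
  intro y
  by_contra hy
  let φ : (V → ZMod 2) →ₗ[ZMod 2] ZMod 2 :=
    ∑ v ∈ Finset.univ.filter (· ∈ S), LinearMap.proj v
  have hφ : ∀ a b, φ (edgeVec a b) =
      (if a ∈ S then (1 : ZMod 2) else 0) + if b ∈ S then 1 else 0 := by
    intro a b
    simp [φ, edgeVec, Finset.sum_add_distrib, LinearMap.sum_apply]
  have hker : span (ZMod 2) (Set.range w) ≤ LinearMap.ker φ := by
    rw [span_le]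
    rintro _ ⟨i, rfl⟩
    rcases hclosed i with h | ⟨a, b, h, hab⟩
    · simp [h]
    · rw [SetLike.mem_coe, LinearMap.mem_ker, h, hφ, if_congr hab rfl rfl]
      exact CharTwo.add_self_eq_zero _
  have h := hker (hw x y)
  rw [LinearMap.mem_ker, hφ, if_pos hx, if_neg hy] at h
  simp at h

/-- Pairs of elements of `ZMod 2`-vectors indexed by `V`. -/
abbrev PairSpace (V : Type*) : Type _ := (V → ZMod 2) × (V → ZMod 2)

open Module Submodule in
/-- The span of the vectors `(edgeVec x y, 0)` and `(0, edgeVec x y)`. -/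
def edgeSpan (V : Type*) [DecidableEq V] : Submodule (ZMod 2) (PairSpace V) :=
  span (ZMod 2) {p | ∃ x y, p = (edgeVec x y, 0) ∨ p = (0, edgeVec x y)}

open Module Submodule Classical in
theorem finrank_edgeSpan_le {V : Type*} [Fintype V] [DecidableEq V]
    (U : Submodule (ZMod 2) (PairSpace V)) (x : V) :
    finrank (ZMod 2) (edgeSpan V) ≤ finrank (ZMod 2) U + 2 * (Finset.univ.filter
      fun y => ¬ ((edgeVec x y, 0) ∈ U ∧ (0, edgeVec x y) ∈ U)).card := by
  set B := Finset.univ.filter fun y => ¬ ((edgeVec x y, 0) ∈ U ∧ (0, edgeVec x y) ∈ U)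
  let C : Finset (PairSpace V) :=
    B.image (fun y => (edgeVec x y, 0)) ∪ B.image (fun y => (0, edgeVec x y))
  have hC : C.card ≤ 2 * B.card := by
    refine (Finset.card_union_le _ _).trans ?_
    rw [two_mul]
    exact add_le_add Finset.card_image_le Finset.card_image_le
  have hmem : ∀ y, (edgeVec x y, 0) ∈ U ⊔ span (ZMod 2) (C : Set (PairSpace V)) ∧
      (0, edgeVec x y) ∈ U ⊔ span (ZMod 2) (C : Set (PairSpace V)) := by
    intro y
    by_cases hy : y ∈ B
    · exact ⟨mem_sup_right (subset_span (Finset.mem_coe.2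
        (Finset.mem_union_left _ (Finset.mem_image_of_mem _ hy)))),
        mem_sup_right (subset_span (Finset.mem_coe.2
        (Finset.mem_union_right _ (Finset.mem_image_of_mem _ hy))))⟩
    · have h := of_not_not fun h => hy (Finset.mem_filter.2 ⟨Finset.mem_univ _, h⟩)
      exact ⟨mem_sup_left h.1, mem_sup_left h.2⟩
  have hle : edgeSpan V ≤ U ⊔ span (ZMod 2) (C : Set (PairSpace V)) := by
    rw [edgeSpan, span_le]
    rintro _ ⟨y, z, rfl | rfl⟩
    · have h := add_mem (hmem y).1 (hmem z).1
      rw [Prod.mk_add_mk, edgeVec_comm x y, edgeVec_add_edgeVec, add_zero] at h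
      exact h
    · have h := add_mem (hmem y).2 (hmem z).2
      rw [Prod.mk_add_mk, edgeVec_comm x y, edgeVec_add_edgeVec, add_zero] at h
      exact h
  calc finrank (ZMod 2) (edgeSpan V)
      ≤ finrank (ZMod 2) (U ⊔ span (ZMod 2) (C : Set (PairSpace V)) :
          Submodule (ZMod 2) (PairSpace V)) := finrank_mono hle
    _ ≤ finrank (ZMod 2) U + finrank (ZMod 2) (span (ZMod 2) (C : Set (PairSpace V))) :=
        finrank_add_le_finrank_add_finrank _ _
    _ ≤ _ := Nat.add_le_add_left ((finrank_span_finset_le_card C).trans hC) _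

open Classical in
/-- The vectors `(edgeVec x y, 0)` and `(0, edgeVec x y)` for distinct `x, y ∈ A`. -/
noncomputable def edgeVecs {V : Type*} [DecidableEq V] (A : Finset V) : Finset (PairSpace V) :=
  A.offDiag.image (fun p => (edgeVec p.1 p.2, 0)) ∪
    A.offDiag.image (fun p => (0, edgeVec p.1 p.2))

theorem mem_edgeVecs {V : Type*} [DecidableEq V] {A : Finset V} {a : PairSpace V} :
    a ∈ edgeVecs A ↔ ∃ x y, x ∈ A ∧ y ∈ A ∧ x ≠ y ∧
      (a = (edgeVec x y, 0) ∨ a = (0, edgeVec x y)) := by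
  simp only [edgeVecs, Finset.mem_union, Finset.mem_image, Finset.mem_offDiag, Prod.exists]
  constructor
  · rintro (⟨x, y, h, rfl⟩ | ⟨x, y, h, rfl⟩)
    · exact ⟨x, y, h.1, h.2.1, h.2.2, .inl rfl⟩
    · exact ⟨x, y, h.1, h.2.1, h.2.2, .inr rfl⟩
  · rintro ⟨x, y, h1, h2, h3, rfl | rfl⟩
    · exact .inl ⟨x, y, ⟨h1, h2, h3⟩, rfl⟩
    · exact .inr ⟨x, y, ⟨h1, h2, h3⟩, rfl⟩

open Classical in
theorem finrank_edgeSpan_le_add_card {V ι : Type*} [Fintype V] [Fintype ι] [DecidableEq V]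
    (E : ι → Finset V) (k : ℕ) (hunif : ∀ i, (E i).card = k) (hk : 2 ≤ k)
    (hn : 2 * (k - 1) ≤ Fintype.card V)
    (hdeg : ∀ T : Finset V, T.card = 2 → k ≤ (Finset.univ.filter fun i => T ⊆ E i).card)
    (U : Submodule (ZMod 2) (PairSpace V)) :
    Module.finrank (ZMod 2) (edgeSpan V) ≤ Module.finrank (ZMod 2) U +
      (Finset.univ.filter fun i => ¬ ∀ a ∈ edgeVecs (E i), a ∈ U).card := by
  set Cr := Finset.univ.filter (fun i => ¬ ∀ a ∈ edgeVecs (E i), a ∈ U) with hCr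
  set bad := (Finset.univ : Finset (V × V)).filter fun p =>
    ¬ ((edgeVec p.1 p.2, 0) ∈ U ∧ (0, edgeVec p.1 p.2) ∈ U) with hbad
  have hne : ∀ p ∈ bad, p.1 ≠ p.2 := by
    rintro ⟨x, y⟩ hp (rfl : x = y)
    rw [hbad, Finset.mem_filter, edgeVec_self] at hp
    exact hp.2 ⟨U.zero_mem, U.zero_mem⟩
  have hcount : bad.card * k ≤ Cr.card * (k * k - k) := by
    refine Finset.card_mul_le_card_mul (fun p i => {p.1, p.2} ⊆ E i) (fun p hp => ?_)
      fun i _ => ?_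
    · refine (hdeg {p.1, p.2} (Finset.card_pair (hne p hp))).trans
        (Finset.card_le_card fun i hi => ?_)
      rw [Finset.mem_filter] at hi
      refine Finset.mem_filter.2 ⟨Finset.mem_filter.2 ⟨Finset.mem_univ _, fun h => ?_⟩, hi.2⟩
      have h1 : p.1 ∈ E i := hi.2 (by simp)
      have h2 : p.2 ∈ E i := hi.2 (by simp)
      exact (Finset.mem_filter.1 hp).2 ⟨h _ (mem_edgeVecs.2 ⟨_, _, h1, h2, hne p hp, .inl rfl⟩),
        h _ (mem_edgeVecs.2 ⟨_, _, h1, h2, hne p hp, .inr rfl⟩)⟩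
    · rw [← hunif i, ← Finset.offDiag_card]
      refine Finset.card_le_card fun p hp => ?_
      rw [Finset.mem_bipartiteBelow] at hp
      exact Finset.mem_offDiag.2 ⟨hp.2 (by simp), hp.2 (by simp), hne p hp.1⟩
  have hsum : Fintype.card V * Module.finrank (ZMod 2) (edgeSpan V) ≤
      Fintype.card V * Module.finrank (ZMod 2) U + 2 * bad.card := by
    have h := Finset.sum_le_sum fun x (_ : x ∈ Finset.univ) => finrank_edgeSpan_le U x
    rw [Finset.sum_add_distrib, Finset.sum_const, Finset.sum_const, Finset.card_univ,
      smul_eq_mul, smul_eq_mul, ← Finset.mul_sum] at h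
    rw [hbad, Finset.card_filter, Fintype.sum_prod_type]
    simpa only [Finset.card_filter] using h
  obtain ⟨j, rfl⟩ : ∃ j, k = j + 2 := ⟨k - 2, by omega⟩
  have hb : bad.card ≤ Cr.card * (j + 1) := by
    have : (j + 2) * (j + 2) - (j + 2) = (j + 1) * (j + 2) := by
      rw [Nat.sub_eq_iff_eq_add (by nlinarith)]; ring
    rw [this, ← mul_assoc] at hcount
    exact Nat.le_of_mul_le_mul_right hcount (by omega)
  have hcard : 2 * (j + 1) ≤ Fintype.card V := hn
  refine Nat.le_of_mul_le_mul_left (hsum.trans ?_) (by omega : 0 < Fintype.card V)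
  change _ ≤ _ * (_ + Cr.card)
  nlinarith [Nat.mul_le_mul_left Cr.card hcard]

/-- If every pair of vertices lies in at least `k` edges of a `k`-uniform hypergraph on at
least `2 (k - 1)` vertices, then one can choose a pair of vertices in each edge such that
the multigraph of chosen pairs contains two edge-disjoint connected spanning subgraphs. -/
theorem exists_two_spanning_of_two_degree {V ι : Type*} [Fintype V] [Fintype ι] [DecidableEq V]
    (E : ι → Finset V) (k : ℕ) (hunif : ∀ i, (E i).card = k) (hk : 2 ≤ k)
    (hn : 2 * (k - 1) ≤ Fintype.card V)
    (hdeg : ∀ T : Finset V, T.card = 2 → k ≤ (Finset.univ.filter fun i => T ⊆ E i).card) :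
    ∃ (s t : ι → V) (A : Set ι), (∀ i, s i ∈ E i ∧ t i ∈ E i ∧ s i ≠ t i) ∧ ∀ x y,
      edgeVec x y ∈ Submodule.span (ZMod 2)
        (Set.range (Set.indicator A fun i => edgeVec (s i) (t i))) ∧
      edgeVec x y ∈ Submodule.span (ZMod 2)
        (Set.range (Set.indicator Aᶜ fun i => edgeVec (s i) (t i))) := by
  classical
  obtain ⟨v, hv, hspan⟩ := exists_spanning_transversal (edgeSpan V) (fun i => edgeVecs (E i))
    (fun i => by
      obtain ⟨x, hx, y, hy, hxy⟩ := Finset.one_lt_card.1 (lt_of_lt_of_eq hk (hunif i).symm)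
      exact ⟨_, mem_edgeVecs.2 ⟨x, y, hx, hy, hxy, .inl rfl⟩⟩)
    (fun i a ha => by
      obtain ⟨x, y, -, -, -, h⟩ := mem_edgeVecs.1 ha
      exact Submodule.subset_span ⟨x, y, h⟩)
    (fun U _ => by convert finrank_edgeSpan_le_add_card E k hunif hk hn (by convert hdeg) U)
  choose s t hs ht hst hv' using fun i => mem_edgeVecs.1 (hv i)
  refine ⟨s, t, {i | v i = (edgeVec (s i) (t i), 0)},
    fun i => ⟨hs i, ht i, hst i⟩, fun x y => ⟨?_, ?_⟩⟩
  · have h : (edgeVec x y, 0) ∈ Submodule.span (ZMod 2) (Set.range v) :=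
      hspan (Submodule.subset_span ⟨x, y, .inl rfl⟩)
    have h' := Submodule.mem_map_of_mem (f := LinearMap.fst (ZMod 2) _ _) h
    have hfun : LinearMap.fst (ZMod 2) _ _ ∘ v = Set.indicator
        {i | v i = (edgeVec (s i) (t i), 0)}
        (fun i => edgeVec (s i) (t i)) := by
      funext i
      by_cases hi : v i = (edgeVec (s i) (t i), 0)
      · rw [Set.indicator_of_mem (by exact hi), Function.comp_apply, hi, LinearMap.fst_apply]
      · rw [Set.indicator_of_notMem (by exact hi), Function.comp_apply,
          (hv' i).resolve_left hi, LinearMap.fst_apply]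
    rw [Submodule.map_span, ← Set.range_comp, hfun] at h'
    exact h'
  · have h : (0, edgeVec x y) ∈ Submodule.span (ZMod 2) (Set.range v) :=
      hspan (Submodule.subset_span ⟨x, y, .inr rfl⟩)
    have h' := Submodule.mem_map_of_mem (f := LinearMap.snd (ZMod 2) _ _) h
    have hfun : LinearMap.snd (ZMod 2) _ _ ∘ v = Set.indicator
        {i | v i = (edgeVec (s i) (t i), 0)}ᶜ
        (fun i => edgeVec (s i) (t i)) := by
      funext i
      by_cases hi : v i = (edgeVec (s i) (t i), 0)
      · rw [Set.indicator_of_notMem (by simpa using hi), Function.comp_apply, hi,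
          LinearMap.snd_apply]
      · rw [Set.indicator_of_mem (by exact hi), Function.comp_apply,
          (hv' i).resolve_left hi, LinearMap.snd_apply]
    rw [Submodule.map_span, ← Set.range_comp, hfun] at h'
    exact h'

theorem hasSpanningEulerTour_of_two_degree {V ι : Type*} [Fintype V] [Fintype ι] [DecidableEq V]
    (E : ι → Finset V) (k : ℕ) (hunif : ∀ i, (E i).card = k) (hk : 3 ≤ k)
    (hn : 2 * (k - 1) ≤ Fintype.card V)
    (hdeg : ∀ T : Finset V, T.card = 2 → k ≤ (Finset.univ.filter fun i => T ⊆ E i).card) :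
    HasSpanningEulerTour E := by
  classical
  obtain ⟨s, t, A, hE, hA⟩ := exists_two_spanning_of_two_degree E k hunif (by omega) hn hdeg
  have : Nonempty ι := by
    obtain ⟨T, -, hT⟩ := Finset.exists_subset_card_eq
      (show 2 ≤ (Finset.univ : Finset V).card by rw [Finset.card_univ]; omega)
    obtain ⟨i, -⟩ := Finset.card_pos.1 (lt_of_lt_of_le (by omega) (hdeg T hT))
    exact ⟨i⟩
  have hz : ∀ i, ∃ z ∈ E i, z ∉ ({s i, t i} : Finset V) := fun i =>
    Finset.exists_mem_notMem_of_card_lt_card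
      (lt_of_le_of_lt Finset.card_le_two (by rw [hunif]; omega))
  choose z hzE hz using hz
  simp only [Finset.mem_insert, Finset.mem_singleton, not_or] at hz
  have hd : ∑ i, edgeVec (if i ∈ A then t i else z i) (s i) ∈ Submodule.span (ZMod 2)
      (Set.range (Set.indicator Aᶜ fun i => edgeVec (s i) (t i))) :=
    Submodule.sum_mem _ fun i _ => (hA _ _).2
  obtain ⟨c, hc⟩ := (Submodule.mem_span_range_iff_exists_fun _).1 hd
  refine hasSpanningEulerTour_of_endpoints E (fun i => if i ∈ A then t i else z i)
    (fun i => if i ∉ A ∧ c i ≠ 0 then t i else s i) (fun i => ?_) (fun i => ?_) (fun i => ?_)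
    ?_ ?_
  · split_ifs
    exacts [(hE i).2.1, hzE i]
  · split_ifs
    exacts [(hE i).2.1, (hE i).1]
  · by_cases hi : i ∈ A
    · simpa [hi] using (hE i).2.2.symm
    · simp only [hi, if_false, not_false_eq_true, true_and]
      split_ifs
      exacts [(hz i).2, (hz i).1]
  · have hterm : ∀ i, edgeVec (if i ∈ A then t i else z i)
        (if i ∉ A ∧ c i ≠ 0 then t i else s i) = edgeVec (if i ∈ A then t i else z i) (s i) +
        c i • Set.indicator Aᶜ (fun i => edgeVec (s i) (t i)) i := by
      intro i
      by_cases hi : i ∈ A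
      · simp [hi]
      · by_cases hci : c i = 0
        · simp [hi, hci]
        · have : c i = 1 := by
            generalize c i = a at hci
            revert a
            decide
          simp [hi, this, edgeVec_add_edgeVec]
    rw [Finset.sum_congr rfl fun i _ => hterm i, Finset.sum_add_distrib, hc]
    exact funext fun _ => CharTwo.add_self_eq_zero _
  · intro S hS hclosed
    refine eq_univ_of_edgeVec_mem_span _ (fun x y => (hA x y).1) S hS fun i => ?_
    by_cases hi : i ∈ A
    · refine .inr ⟨s i, t i, Set.indicator_of_mem hi _, ?_⟩
      simpa [hi] using (hclosed i).symm
    · exact .inl (Set.indicator_of_notMem hi _)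

/-- If every `(j + 2)`-set of vertices lies in an edge of a `k`-uniform hypergraph, then
counting the `j`-sets extending a pair bounds the degree of the pair from below. -/
theorem choose_le_two_degree_mul {V ι : Type*} [Fintype V] [Fintype ι] [DecidableEq V]
    (E : ι → Finset V) (k j : ℕ) (hunif : ∀ i, (E i).card = k)
    (hdeg : ∀ T : Finset V, T.card = j + 2 → ∃ i, T ⊆ E i) (T : Finset V) (hT : T.card = 2) :
    (Fintype.card V - 2).choose j ≤
      (Finset.univ.filter fun i => T ⊆ E i).card * (k - 2).choose j := by
  have h := Finset.card_mul_le_card_mul (s := Tᶜ.powersetCard j)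
    (t := Finset.univ.filter fun i => T ⊆ E i) (m := 1) (n := (k - 2).choose j)
    (fun R i => R ⊆ E i) (fun R hR => ?_) (fun i hi => ?_)
  · rwa [mul_one, Finset.card_powersetCard, Finset.card_compl, hT] at h
  · rw [Finset.mem_powersetCard, Finset.subset_compl_iff_disjoint_right] at hR
    obtain ⟨i, hi⟩ := hdeg (R ∪ T) (by rw [Finset.card_union_of_disjoint hR.1, hR.2, hT])
    exact Finset.card_pos.2 ⟨i, Finset.mem_filter.2 ⟨Finset.mem_filter.2 ⟨Finset.mem_univ _,
      Finset.union_subset_right hi⟩, Finset.union_subset_left hi⟩⟩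
  · rw [Finset.mem_filter] at hi
    rw [← hunif i, ← hT, ← Finset.card_sdiff_of_subset hi.2, ← Finset.card_powersetCard]
    refine Finset.card_le_card fun R hR => ?_
    rw [Finset.mem_bipartiteBelow, Finset.mem_powersetCard] at hR
    rw [Finset.mem_powersetCard]
    refine ⟨fun x hx => Finset.mem_sdiff.2 ⟨hR.2 hx, ?_⟩, hR.1.2⟩
    exact Finset.mem_compl.1 (hR.1.1 hx)

theorem two_mul_choose_two (n : ℕ) : 2 * (n + 1).choose 2 = (n + 1) * n := by
  rw [Nat.choose_two_right, Nat.mul_div_cancel' (Nat.even_mul_pred_self (n + 1)).two_dvd,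
    Nat.add_sub_cancel]

/-- **Corollary 1.5.** An `n`-vertex `k`-uniform hypergraph `𝒢` has a spanning Euler tour
if any of the following holds:
(i) `k = 3`, `n ≥ 7`, and `δ₂(𝒢) ≥ 3`;
(ii) `k ≥ 4` and either (`δ₂(𝒢) ≥ k` and `n ≥ C(k,2) + 1`) or (`δ₃(𝒢) ≥ 1` and
`n ≥ k² − 3k + 5`);
(iii) `k ≥ 5`, `n ≥ C(k,2) + 1`, and `δ_r(𝒢) ≥ 1` for some `r` with `4 ≤ r ≤ k`. -/
theorem hasSpanningEulerTour_of_uniform {V ι : Type*} [Fintype V] [Fintype ι]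
    [DecidableEq V] (E : ι → Finset V) (k : ℕ) (hunif : ∀ i, (E i).card = k)
    (h :
      (k = 3 ∧ 7 ≤ Fintype.card V ∧
        ∀ T : Finset V, T.card = 2 →
          3 ≤ (Finset.univ.filter (fun i => T ⊆ E i)).card) ∨
      (4 ≤ k ∧
        ((k.choose 2 + 1 ≤ Fintype.card V ∧
            ∀ T : Finset V, T.card = 2 →
              k ≤ (Finset.univ.filter (fun i => T ⊆ E i)).card) ∨
          (k ^ 2 - 3 * k + 5 ≤ Fintype.card V ∧
            ∀ T : Finset V, T.card = 3 →
              1 ≤ (Finset.univ.filter (fun i => T ⊆ E i)).card))) ∨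
      (5 ≤ k ∧ k.choose 2 + 1 ≤ Fintype.card V ∧
        ∃ r, 4 ≤ r ∧ r ≤ k ∧
          ∀ T : Finset V, T.card = r →
            1 ≤ (Finset.univ.filter (fun i => T ⊆ E i)).card)) :
    HasSpanningEulerTour E := by
  have hbig : 4 ≤ k → k.choose 2 + 1 ≤ Fintype.card V → 2 * (k - 1) ≤ Fintype.card V := by
    intro hk hn
    obtain ⟨m, rfl⟩ : ∃ m, k = m + 4 := ⟨k - 4, by omega⟩
    have h := two_mul_choose_two (m + 3)
    have : 2 * (m + 4 - 1) = 2 * m + 6 := by omega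
    nlinarith
  rcases h with ⟨rfl, hn, hdeg⟩ | ⟨hk, ⟨hn, hdeg⟩ | ⟨hn, hdeg⟩⟩ | ⟨hk, hn, r, hr, hrk, hdeg⟩
  · exact hasSpanningEulerTour_of_two_degree E 3 hunif le_rfl (by omega) hdeg
  · exact hasSpanningEulerTour_of_two_degree E k hunif (by omega) (hbig hk hn) hdeg
  · obtain ⟨m, rfl⟩ : ∃ m, k = m + 4 := ⟨k - 4, by omega⟩
    have hsq : (m + 4) ^ 2 - 3 * (m + 4) + 5 = (m + 3) * (m + 2) + 3 := by
      have : (m + 4) ^ 2 = (m + 3) * (m + 2) + 3 * (m + 4) - 2 := by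
        rw [eq_comm, Nat.sub_eq_iff_eq_add (by omega)]; ring
      have : 6 ≤ (m + 3) * (m + 2) := by nlinarith
      omega
    rw [hsq] at hn
    refine hasSpanningEulerTour_of_two_degree E _ hunif (by omega) ?_ fun T hT => ?_
    · have : 2 * (m + 4 - 1) = 2 * m + 6 := by omega
      nlinarith
    · have h := choose_le_two_degree_mul E _ 1 hunif (fun T hT => by
        obtain ⟨i, hi⟩ := Finset.card_pos.1 (hdeg T hT)
        exact ⟨i, (Finset.mem_filter.1 hi).2⟩) T hT
      rw [Nat.choose_one_right, Nat.choose_one_right] at h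
      have h' : m + 4 - 2 = m + 2 := by omega
      rw [h'] at h
      by_contra! hlt
      have := Nat.mul_le_mul_right (m + 2) (Nat.le_of_lt_succ hlt)
      omega
  · refine hasSpanningEulerTour_of_two_degree E k hunif (by omega) (hbig (by omega) hn)
      fun T hT => ?_
    obtain ⟨m, rfl⟩ : ∃ m, k = m + 5 := ⟨k - 5, by omega⟩
    have hch : 2 * (m + 5).choose 2 = (m + 5) * (m + 4) := two_mul_choose_two (m + 4)
    have hdeg' : ∀ T : Finset V, T.card = 2 + 2 → ∃ i, T ⊆ E i := by
      intro T hT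
      obtain ⟨R, hTR, hR⟩ := Finset.exists_superset_card_eq (s := T) (n := r) (by omega)
        (by nlinarith)
      obtain ⟨i, hi⟩ := Finset.card_pos.1 (hdeg R hR)
      exact ⟨i, hTR.trans (Finset.mem_filter.1 hi).2⟩
    have h := choose_le_two_degree_mul E _ 2 hunif hdeg' T hT
    obtain ⟨N, hN⟩ : ∃ N, Fintype.card V = N + 3 := ⟨Fintype.card V - 3, by
      have : 4 ≤ (m + 5).choose 2 := by nlinarith
      omega⟩
    have h1 : Fintype.card V - 2 = N + 1 := by omega
    have h2 : m + 5 - 2 = m + 2 + 1 := by omega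
    rw [h1, h2] at h
    have h3 := two_mul_choose_two N
    have h4 := two_mul_choose_two (m + 2)
    have h5 : (m + 5) * (m + 4) ≤ 2 * N + 4 := by
      rw [hN] at hn
      omega
    by_contra! hlt
    have h6 := Nat.mul_le_mul_right ((m + 2 + 1).choose 2) (Nat.le_of_lt_succ hlt)
    have h7 : (N + 1) * N ≤ (m + 4) * ((m + 3) * (m + 2)) := by
      rw [← h3, ← h4, mul_left_comm]
      exact Nat.mul_le_mul_left 2 (h.trans h6)
    have h8 : (m ^ 2 + 9 * m + 18) * (m ^ 2 + 9 * m + 16) ≤ (2 * N + 2) * (2 * N) :=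
      Nat.mul_le_mul (by nlinarith) (by nlinarith)
    nlinarith [Nat.zero_le (m ^ 4), Nat.zero_le (m ^ 3), Nat.zero_le (m ^ 2)]
end

section
/- A Steiner quadruple system of order n has a spanning Euler tour if and only if n ≥ 8 and n ≡ 2 or 4 (mod 6). -/
open Finset

section Euler

variable {V ι : Type*}

/-- `IsWalkList s t u l w`: the edge list `l` is a walk from `u` to `w` in the multigraph whose
edge `i` joins `s i` and `t i`. -/
inductive IsWalkList (s t : ι → V) : V → List ι → V → Prop
  | nil (u : V) : IsWalkList s t u [] u
  | cons {i : ι} {u v w : V} {l : List ι}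
      (h : (s i = u ∧ t i = v) ∨ (s i = v ∧ t i = u)) (hl : IsWalkList s t v l w) :
      IsWalkList s t u (i :: l) w

lemma single_add_self [DecidableEq V] (v : V) :
    (Pi.single v 1 + Pi.single v 1 : V → ZMod 2) = 0 := by
  rw [← Pi.single_add, CharTwo.add_self_eq_zero, Pi.single_zero]

namespace IsWalkList

variable {s t : ι → V} {u v w x : V} {l l₁ l₂ : List ι}

lemma append (h₁ : IsWalkList s t u l₁ v) (h₂ : IsWalkList s t v l₂ w) :
    IsWalkList s t u (l₁ ++ l₂) w := by
  induction h₁ with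
  | nil => exact h₂
  | cons h _ ih => exact cons h (ih h₂)

lemma exists_split (h : IsWalkList s t u l w) {i : ι} (hi : i ∈ l) (hx : s i = x ∨ t i = x) :
    ∃ l₁ l₂, l = l₁ ++ l₂ ∧ IsWalkList s t u l₁ x ∧ IsWalkList s t x l₂ w := by
  induction h with
  | nil => simp at hi
  | @cons j u v w l h hl ih =>
    by_cases hxu : x = u
    · subst hxu
      exact ⟨[], j :: l, rfl, nil _, cons h hl⟩
    by_cases hxv : x = v
    · subst hxv
      exact ⟨[j], l, rfl, cons h (nil _), hl⟩
    have hil : i ∈ l := by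
      rcases List.mem_cons.1 hi with rfl | hil
      · grind
      · exact hil
    obtain ⟨l₁, l₂, rfl, h₁, h₂⟩ := ih hil
    exact ⟨j :: l₁, l₂, rfl, cons h h₁, h₂⟩

lemma sum_single [DecidableEq V] (h : IsWalkList s t u l w) :
    (l.map fun i => (Pi.single (s i) 1 + Pi.single (t i) 1 : V → ZMod 2)).sum =
      Pi.single u 1 + Pi.single w 1 := by
  induction h with
  | nil u => exact (single_add_self u).symm
  | @cons j u v w l h _ ih =>
    rw [List.map_cons, List.sum_cons, ih]
    have hv := single_add_self v
    rcases h with ⟨rfl, rfl⟩ | ⟨rfl, rfl⟩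
    · linear_combination hv
    · linear_combination hv

lemma exists_vtx (h : IsWalkList s t u l w) :
    ∃ f : ℕ → V, f 0 = u ∧ f l.length = w ∧ ∀ (j : ℕ) (hj : j < l.length),
      (s l[j] = f j ∧ t l[j] = f (j + 1)) ∨ (s l[j] = f (j + 1) ∧ t l[j] = f j) := by
  induction h with
  | nil u => exact ⟨fun _ => u, rfl, rfl, by simp⟩
  | @cons i u v w l h _ ih =>
    obtain ⟨f, h0, hn, hf⟩ := ih
    refine ⟨fun k => Nat.casesOn k u f, rfl, hn, ?_⟩
    rintro (_ | j) hj
    · simpa [h0] using h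
    · simpa using hf j (by simpa using hj)

end IsWalkList

/-- Euler's theorem for finite multigraphs, with connectedness stated in terms of cuts. -/
lemma exists_eulerian_list [Fintype ι] [DecidableEq V] (s t : ι → V) [Nonempty ι]
    (hconn : ∀ S : Set V, S.Nonempty → (∀ i, s i ∈ S ↔ t i ∈ S) → S = Set.univ)
    (heven : ∑ i, (Pi.single (s i) 1 + Pi.single (t i) 1 : V → ZMod 2) = 0) :
    ∃ u l, IsWalkList s t u l u ∧ l.Nodup ∧ ∀ i, i ∈ l := by
  classical
  have hbdd : BddAbove {k | ∃ u l w, IsWalkList s t u l w ∧ l.Nodup ∧ l.length = k} :=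
    ⟨Fintype.card ι, by rintro _ ⟨u, l, w, -, hl, rfl⟩; exact hl.length_le_card⟩
  obtain ⟨u, l, w, hl, hnd, hlen⟩ := Nat.sSup_mem
    (s := {k | ∃ u l w, IsWalkList s t u l w ∧ l.Nodup ∧ l.length = k})
    ⟨0, s (Classical.arbitrary ι), [], _, .nil _, List.nodup_nil, rfl⟩ hbdd
  -- a walk of maximal length cannot be extended
  have hmax {u' w' l'} (h' : IsWalkList s t u' l' w') (hp : l'.Perm l) {i}
      (hi : s i = u' ∨ t i = u') : i ∈ l := by
    by_contra hil
    have hil' : i ∉ l' := fun h => hil (hp.mem_iff.1 h)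
    obtain ⟨v, hv⟩ : ∃ v, (s i = v ∧ t i = u') ∨ (s i = u' ∧ t i = v) := by
      rcases hi with h | h
      exacts [⟨t i, .inr ⟨h, rfl⟩⟩, ⟨s i, .inl ⟨rfl, h⟩⟩]
    have := le_csSup hbdd ⟨v, i :: l', w', .cons hv h', List.nodup_cons.2
      ⟨hil', hp.nodup_iff.2 hnd⟩, rfl⟩
    rw [← hlen, List.length_cons, hp.length_eq] at this
    omega
  have huw : u = w := by
    by_contra huw
    have h1 := congrFun hl.sum_single u
    rw [← List.sum_toFinset _ hnd] at h1
    have h2 := congrFun heven u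
    rw [← Finset.sum_add_sum_compl l.toFinset, Pi.add_apply, h1, Finset.sum_apply,
      Finset.sum_eq_zero] at h2
    · simp [huw] at h2
    · intro i hi
      have hi' : i ∉ l := by simpa using hi
      have : u ≠ s i := fun h => hi' (hmax hl (.refl _) (.inl h.symm))
      have : u ≠ t i := fun h => hi' (hmax hl (.refl _) (.inr h.symm))
      simp [*]
  subst huw
  refine ⟨u, l, hl, hnd, fun i => ?_⟩
  have huniv := hconn {x | ∀ i, s i = x ∨ t i = x → i ∈ l} ⟨u, fun i hi => hmax hl (.refl _) hi⟩ <| by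
    have key {x j} (hj : j ∈ l) (hx : s j = x ∨ t j = x) : ∀ i, s i = x ∨ t i = x → i ∈ l := by
      obtain ⟨l₁, l₂, rfl, h₁, h₂⟩ := hl.exists_split hj hx
      exact fun i hi => hmax (h₂.append h₁) List.perm_append_comm hi
    exact fun i => ⟨fun h => key (h i (.inl rfl)) (.inr rfl),
      fun h => key (h i (.inr rfl)) (.inl rfl)⟩
  exact (huniv ▸ Set.mem_univ (s i) : s i ∈ {x | ∀ i, s i = x ∨ t i = x → i ∈ l}) i (.inl rfl)

/-- A choice of two vertices in each edge that yields a connected even multigraph gives a spanning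
Euler tour. -/
lemma hasSpanningEulerTour_of_choice [Fintype ι] [DecidableEq V] [Nonempty ι] [Nontrivial V]
    {E : ι → Finset V}
    (s t : ι → V) (hs : ∀ i, s i ∈ E i) (ht : ∀ i, t i ∈ E i) (hst : ∀ i, s i ≠ t i)
    (hconn : ∀ S : Set V, S.Nonempty → (∀ i, s i ∈ S ↔ t i ∈ S) → S = Set.univ)
    (heven : ∑ i, (Pi.single (s i) 1 + Pi.single (t i) 1 : V → ZMod 2) = 0) :
    HasSpanningEulerTour E := by
  classical
  obtain ⟨u, l, hl, hnd, hmem⟩ := exists_eulerian_list s t hconn heven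
  obtain ⟨f, hf0, hfn, hf⟩ := hl.exists_vtx
  have hpos : 0 < l.length := List.length_pos_of_mem (hmem (Classical.arbitrary ι))
  have : NeZero l.length := ⟨hpos.ne'⟩
  have hsucc (i : ZMod l.length) : f (i + 1).val = f (i.val + 1) := by
    rw [ZMod.val_add, ZMod.val_one_eq_one_mod, Nat.add_mod_mod]
    rcases (Nat.succ_le_of_lt (ZMod.val_lt i)).lt_or_eq with h | h
    · rw [Nat.mod_eq_of_lt h]
    · rw [Nat.succ_eq_add_one] at h
      rw [h, Nat.mod_self, hf0, hfn]
  have hf' (i : ZMod l.length) := hf i.val (ZMod.val_lt i)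
  refine ⟨⟨l.length, hpos, fun i => f i.val, fun i => l[i.val]'(ZMod.val_lt i), fun i => ?_,
    fun i => ?_, fun i => ?_⟩, fun e => ?_, fun v => ?_⟩
  · have := hs (l[i.val]'(ZMod.val_lt i)); have := ht (l[i.val]'(ZMod.val_lt i)); grind
  · have := hs (l[i.val]'(ZMod.val_lt i)); have := ht (l[i.val]'(ZMod.val_lt i)); grind
  · have := hst (l[i.val]'(ZMod.val_lt i)); grind
  · obtain ⟨k, hk, rfl⟩ := List.getElem_of_mem (hmem e)
    refine ⟨(k : ZMod l.length), by simp [ZMod.val_natCast, Nat.mod_eq_of_lt hk], fun i hi => ?_⟩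
    have := (hnd.getElem_inj_iff).1 hi
    rw [← this, ZMod.natCast_zmod_val]
  · obtain ⟨i, hi⟩ : ∃ i, s i = v ∨ t i = v := by
      by_contra! hv
      have := hconn {v} (Set.singleton_nonempty v) (fun i => by simp [hv i])
      obtain ⟨w, hw⟩ := exists_ne v
      exact hw (by simpa using (this ▸ Set.mem_univ w : w ∈ ({v} : Set V)))
    obtain ⟨k, hk, rfl⟩ := List.getElem_of_mem (hmem i)
    have hk' : (k : ZMod l.length).val = k := by simp [ZMod.val_natCast, Nat.mod_eq_of_lt hk]
    have := hf k hk
    by_cases h : f k = v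
    · exact ⟨(k : ZMod l.length), by simpa only [hk'] using h⟩
    · refine ⟨(k : ZMod l.length) + 1, ?_⟩
      simp only [hsucc, hk']
      grind

end Euler

section Choice

variable {V ι : Type*} [DecidableEq V]

/-- A bipartite relation whose degrees are at least `k` on the left (over `A`) and at most `k` on
the right has a matching covering `A`. -/
lemma exists_injOn_of_degree [Fintype ι] [Nonempty ι] (A : Finset V) (r : V → ι → Prop)
    [∀ v i, Decidable (r v i)] {k : ℕ} (hk : 0 < k)
    (hl : ∀ v ∈ A, k ≤ #{i | r v i}) (hr : ∀ i, #{v ∈ A | r v i} ≤ k) :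
    ∃ f : V → ι, Set.InjOn f A ∧ ∀ v ∈ A, r v (f v) := by
  classical
  obtain ⟨f, hf, hrf⟩ := (Fintype.all_card_le_filter_rel_iff_exists_injective
    (fun (v : A) (i : ι) => r v i)).1 fun B => by
      refine Nat.le_of_mul_le_mul_right (Finset.card_mul_le_card_mul
        (fun (v : A) (i : ι) => r v i) (fun v hv => ?_) fun i _ => ?_) hk
      · refine (hl v v.2).trans (Finset.card_le_card fun i hi => ?_)
        simp only [mem_filter, mem_univ, true_and, bipartiteAbove] at hi ⊢
        exact ⟨⟨v, hv, hi⟩, hi⟩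
      · refine le_trans ?_ (hr i)
        refine Finset.card_le_card_of_injOn Subtype.val (fun v hv => ?_)
          Subtype.val_injective.injOn
        have := (Finset.mem_filter.1 (Finset.mem_coe.1 hv)).2
        simpa using this
  refine ⟨fun v => if h : v ∈ A then f ⟨v, h⟩ else Classical.arbitrary ι, ?_, ?_⟩
  · intro u hu v hv huv
    simp only [Finset.mem_coe] at hu hv
    simp only [hu, hv, dite_true] at huv
    exact congrArg Subtype.val (hf huv)
  · intro v hv
    simpa [hv] using hrf ⟨v, hv⟩

/-- If every nonempty subset of `X` contains some `v` whose set `F v` leaves that subset, then the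
elements of `X` can be given parents in these sets so that they all lead out of `X`. -/
lemma exists_parent (F : V → Finset V) (X : Finset V)
    (hF : ∀ Y ⊆ X, Y.Nonempty → ∃ v ∈ Y, ∃ y ∈ F v, y ∉ Y) :
    ∃ par : V → V, (∀ v ∈ X, par v ∈ F v ∧ par v ≠ v) ∧
      ∀ S : Set V, (∀ v ∈ X, ∀ y ∈ F v, y ∉ X → y ∈ S) → (∀ v ∈ X, (v ∈ S ↔ par v ∈ S)) →
        ∀ v ∈ X, v ∈ S := by
  induction X using Finset.strongInduction with
  | H X ih =>
    rcases X.eq_empty_or_nonempty with rfl | hX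
    · exact ⟨id, by simp, by simp⟩
    obtain ⟨v, hv, y, hy, hyX⟩ := hF X Subset.rfl hX
    obtain ⟨par, h1, h2⟩ := ih (X.erase v) (erase_ssubset hv)
      fun Y hY => hF Y (hY.trans (erase_subset _ _))
    have hyv : y ≠ v := fun h => hyX (h ▸ hv)
    refine ⟨Function.update par v y, fun u hu => ?_, fun S hS hpar => ?_⟩
    · by_cases huv : u = v
      · subst huv; simpa using ⟨hy, hyv⟩
      · simpa [huv] using h1 u (mem_erase.2 ⟨huv, hu⟩)
    · have hvS : v ∈ S := by
        have := hpar v hv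
        rw [Function.update_self] at this
        exact this.2 (hS v hv y hy hyX)
      have := h2 S (fun u hu x hx hxX => ?_) fun u hu => ?_
      · intro u hu
        by_cases huv : u = v
        · rwa [huv]
        · exact this u (mem_erase.2 ⟨huv, hu⟩)
      · by_cases hxv : x = v
        · rwa [hxv]
        · exact hS u (mem_of_mem_erase hu) x hx fun h => hxX (mem_erase.2 ⟨hxv, h⟩)
      · have := hpar u (mem_of_mem_erase hu)
        rwa [Function.update_of_ne (ne_of_mem_erase hu)] at this

/-- Edges avoiding `o` that are matched to the vertices other than `o` and `a` can be replaced by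
pairs connecting all vertices other than `o`. -/
lemma exists_connecting_choice [Fintype V] {E : ι → Finset V} (hcard : ∀ i, 2 ≤ (E i).card) {o a : V}
    {φ : V → ι} (hφ : Set.InjOn φ ((univ.erase o).erase a))
    (hmem : ∀ v ∈ (univ.erase o).erase a, v ∈ E (φ v) ∧ o ∉ E (φ v))
    (hF : ∀ Y ⊆ (univ.erase o).erase a, Y.Nonempty → ∃ v ∈ Y, ∃ y ∈ E (φ v), y ∉ Y) :
    ∃ s t : ι → V, (∀ i, s i ∈ E i ∧ t i ∈ E i ∧ s i ≠ t i) ∧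
      ∀ S : Set V, a ∈ S → (∀ i, o ∉ E i → (s i ∈ S ↔ t i ∈ S)) → ∀ x, x ≠ o → x ∈ S := by
  classical
  obtain ⟨par, h1, h2⟩ := exists_parent (fun v => E (φ v)) _ hF
  choose p hp q hq hpq using fun i => Finset.one_lt_card.1 (hcard i)
  have : Nonempty V := ⟨o⟩
  set X := (univ.erase o).erase a
  set g := Function.invFunOn φ (X : Set V)
  have hg : ∀ v ∈ X, g (φ v) = v := fun v hv => hφ.leftInvOn_invFunOn hv
  refine ⟨fun i => if i ∈ X.image φ then g i else p i,
    fun i => if i ∈ X.image φ then par (g i) else q i, fun i => ?_, fun S haS hS x hx => ?_⟩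
  · by_cases hi : i ∈ X.image φ
    · simp only [hi, if_true]
      obtain ⟨v, hv, rfl⟩ := mem_image.1 hi
      rw [hg v hv]
      exact ⟨(hmem v hv).1, (h1 v hv).1, (h1 v hv).2.symm⟩
    · simpa only [hi, if_false] using ⟨hp i, hq i, hpq i⟩
  · by_cases hxa : x = a
    · rwa [hxa]
    refine h2 S (fun v hv y hy hyX => ?_) (fun v hv => ?_) x (by simp [X, hx, hxa])
    · have : y ≠ o := fun h => (hmem v hv).2 (h ▸ hy)
      have : y = a := by by_contra h; exact hyX (mem_erase.2 ⟨h, mem_erase.2 ⟨this, mem_univ y⟩⟩)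
      rwa [this]
    · have := hS (φ v) (hmem v hv).2
      simpa only [mem_image_of_mem φ hv, if_true, hg v hv] using this

/-- A choice of pairs that connects all vertices other than `o` can be modified on edges through `o`
so that it becomes even and connected. -/
lemma hasSpanningEulerTour_of_connecting_choice [Fintype V] [Fintype ι] {E : ι → Finset V} {o a : V} (hao : a ≠ o)
    {e : V → ι} (he : Set.InjOn e (univ.erase o : Finset V))
    (hmem : ∀ v ∈ univ.erase o, v ∈ E (e v) ∧ o ∈ E (e v))
    (hcard : ∀ i, (E i).card = 4) {s t : ι → V}
    (hst : ∀ i, s i ∈ E i ∧ t i ∈ E i ∧ s i ≠ t i)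
    (hconn : ∀ S : Set V, a ∈ S → (∀ i, o ∉ E i → (s i ∈ S ↔ t i ∈ S)) → ∀ x, x ≠ o → x ∈ S) :
    HasSpanningEulerTour E := by
  classical
  have : Nonempty ι := ⟨e o⟩
  have : Nontrivial V := ⟨a, o, hao⟩
  set A : Finset V := univ.erase o
  have haA : a ∈ A := by simp [A, hao]
  set D : V → ZMod 2 := ∑ i ∈ univ \ A.image e, (Pi.single (s i) 1 + Pi.single (t i) 1)
  set h : (V → V) → V → ZMod 2 := fun z => D + ∑ v ∈ A, Pi.single (z v) 1
  have hz2 : ∀ v ∈ A, ∃ z₁ z₂, z₁ ≠ z₂ ∧ (z₁ ∈ E (e v) ∧ z₁ ≠ o ∧ z₁ ≠ v) ∧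
      (z₂ ∈ E (e v) ∧ z₂ ≠ o ∧ z₂ ≠ v) := by
    intro v hv
    have hc : 1 < (((E (e v)).erase o).erase v).card := by
      rw [card_erase_of_mem (mem_erase.2 ⟨ne_of_mem_erase hv, (hmem v hv).1⟩),
        card_erase_of_mem (hmem v hv).2, hcard]
      norm_num
    obtain ⟨z₁, h₁, z₂, h₂, hne⟩ := one_lt_card.1 hc
    simp only [mem_erase] at h₁ h₂
    exact ⟨z₁, z₂, hne, ⟨h₁.2.2, h₁.2.1, h₁.1⟩, ⟨h₂.2.2, h₂.2.1, h₂.1⟩⟩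
  -- the parities prescribe the pairs on the matched edges, and some edge can be used to reach `o`
  obtain ⟨z, hz, c, hcA, hc⟩ : ∃ z : V → V, (∀ v ∈ A, z v ∈ E (e v) ∧ z v ≠ o ∧ z v ≠ v) ∧
      ∃ c ∈ A, h z c = 0 := by
    choose! z w hzw hz hw using hz2
    by_cases hz0 : ∃ c ∈ A, h z c = 0
    · exact ⟨z, hz, hz0⟩
    push Not at hz0
    refine ⟨Function.update z a (w a), fun v hv => ?_, z a, by simpa [A] using (hz a haA).2.1, ?_⟩
    · by_cases hva : v = a
      · subst hva; simpa using hw v hv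
      · simpa [hva] using hz v hv
    · have h1 := hz0 (z a) (by simpa [A] using (hz a haA).2.1)
      simp only [h, Pi.add_apply, Finset.sum_apply, ← Finset.add_sum_erase A _ haA] at h1 ⊢
      rw [Finset.sum_congr rfl (g := fun v => (Pi.single (z v) 1 : V → ZMod 2) (z a))
        (fun v hv => by rw [Function.update_of_ne (ne_of_mem_erase hv)])]
      simp only [Pi.single_eq_same, Function.update_self, Pi.single_eq_of_ne (hzw a haA)] at h1 ⊢
      have key : ∀ x y : ZMod 2, x + (1 + y) ≠ 0 → x + (0 + y) = 0 := by decide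
      exact key _ _ h1
  set ε : V → V := fun v => if h z v = 0 then o else v
  set g := Function.invFunOn e (A : Set V)
  have hg : ∀ v ∈ A, g (e v) = v := fun v hv => he.leftInvOn_invFunOn hv
  set s' : ι → V := fun i => if i ∈ A.image e then ε (g i) else s i
  set t' : ι → V := fun i => if i ∈ A.image e then z (g i) else t i
  have hs' : ∀ v ∈ A, s' (e v) = ε v := fun v hv => by
    simp only [s', mem_image_of_mem e hv, if_true, hg v hv]
  have ht' : ∀ v ∈ A, t' (e v) = z v := fun v hv => by
    simp only [t', mem_image_of_mem e hv, if_true, hg v hv]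
  have hgood : ∀ i, s' i ∈ E i ∧ t' i ∈ E i ∧ s' i ≠ t' i := by
    intro i
    by_cases hi : i ∈ A.image e
    · obtain ⟨v, hv, rfl⟩ := mem_image.1 hi
      rw [hs' v hv, ht' v hv]
      have := hz v hv
      have := hmem v hv
      simp only [ε]
      split_ifs <;> tauto
    · simpa only [s', t', hi, if_false] using hst i
  have hbase : ∀ S : Set V, a ∈ S → (∀ i, s' i ∈ S ↔ t' i ∈ S) → S = Set.univ := by
    intro S haS hS
    have hoff := hconn S haS fun i hi => by
      have hi' : i ∉ A.image e := fun h => by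
        obtain ⟨v, hv, rfl⟩ := mem_image.1 h
        exact hi (hmem v hv).2
      simpa only [s', t', hi', if_false] using hS i
    refine Set.eq_univ_of_forall fun x => ?_
    by_cases hx : x = o
    · have := hS (e c)
      rw [hs' c hcA, ht' c hcA] at this
      simp only [ε, hc, if_true] at this
      rw [hx]
      exact this.2 (hoff _ (hz c hcA).2.1)
    · exact hoff x hx
  have hA0 : ∀ x ∈ A, (∑ i, (Pi.single (s' i) 1 + Pi.single (t' i) 1) : V → ZMod 2) x = 0 := by
    intro x hx
    rw [← Finset.sum_sdiff (subset_univ (A.image e)), Finset.sum_image he,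
      Finset.sum_congr rfl (g := fun i => (Pi.single (s i) 1 + Pi.single (t i) 1 : V → ZMod 2))
        fun i hi => by
          have hi' : i ∉ A.image e := (mem_sdiff.1 hi).2
          simp only [s', t', hi', if_false],
      Finset.sum_congr (s₁ := A) rfl
        (g := fun v => (Pi.single (ε v) 1 + Pi.single (z v) 1 : V → ZMod 2))
        fun v hv => by rw [hs' v hv, ht' v hv], Finset.sum_add_distrib (s := A)]
    have hεx : (∑ v ∈ A, Pi.single (ε v) 1 : V → ZMod 2) x = h z x := by
      rw [Finset.sum_apply, Finset.sum_eq_single_of_mem x hx]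
      · simp only [ε]
        have key : ∀ y : ZMod 2, y ≠ 0 → y = 1 := by decide
        split_ifs with h0
        · rw [h0, Pi.single_eq_of_ne (ne_of_mem_erase hx)]
        · rw [Pi.single_eq_same, key _ h0]
      · intro v _ hvx
        simp only [ε]
        split_ifs
        · exact Pi.single_eq_of_ne (ne_of_mem_erase hx) _
        · exact Pi.single_eq_of_ne hvx.symm _
    have : h z x = D x + (∑ v ∈ A, Pi.single (z v) 1 : V → ZMod 2) x := rfl
    simp only [Pi.add_apply]
    rw [hεx, add_left_comm, ← this, CharTwo.add_self_eq_zero]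
  refine hasSpanningEulerTour_of_choice s' t' (fun i => (hgood i).1) (fun i => (hgood i).2.1)
    (fun i => (hgood i).2.2) (fun S hne hS => ?_) ?_
  · by_cases haS : a ∈ S
    · exact hbase S haS hS
    · have := hbase Sᶜ haS fun i => not_congr (hS i)
      rw [Set.compl_univ_iff] at this
      exact absurd this hne.ne_empty
  · ext x
    by_cases hx : x = o
    · have htot : ∑ x, (∑ i, (Pi.single (s' i) 1 + Pi.single (t' i) 1) : V → ZMod 2) x = 0 := by
        simp only [Finset.sum_apply]
        rw [Finset.sum_comm]
        refine Finset.sum_eq_zero fun i _ => ?_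
        simp only [Pi.add_apply, Finset.sum_add_distrib, Finset.sum_pi_single']
        simp [CharTwo.add_self_eq_zero]
      rw [← Finset.add_sum_erase univ _ (mem_univ o), Finset.sum_eq_zero hA0, add_zero] at htot
      rw [hx, htot, Pi.zero_apply]
    · exact hA0 x (by simp [A, hx])

end Choice

/-- Every `3`-subset of `V` lies in exactly one of the edges `E i`, all of size `4`. -/
structure IsSteinerQuadruple {V ι : Type*} (E : ι → Finset V) : Prop where
  card_eq : ∀ i, (E i).card = 4
  existsUnique : ∀ T : Finset V, T.card = 3 → ∃! i, T ⊆ E i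

namespace IsSteinerQuadruple

variable {V ι : Type*} {E : ι → Finset V}

/-- A set containing a distinct edge for each of its elements has at least `7` elements. -/
lemma seven_le_card (hE : IsSteinerQuadruple E) {Y : Finset V} (hY : Y.Nonempty) {φ : V → ι}
    (hφ : Set.InjOn φ Y) (hsub : ∀ v ∈ Y, E (φ v) ⊆ Y) : 7 ≤ #Y := by
  have h : #(Y.sigma fun v => (E (φ v)).powersetCard 3) ≤ #(Y.powersetCard 3) := by
    refine Finset.card_le_card_of_injOn Sigma.snd (fun p hp => ?_) fun p hp q hq hpq => ?_
    · simp only [coe_sigma, Set.mem_sigma_iff, mem_coe, mem_powersetCard] at hp ⊢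
      exact ⟨hp.2.1.trans (hsub _ hp.1), hp.2.2⟩
    · simp only [coe_sigma, Set.mem_sigma_iff, mem_coe, mem_powersetCard] at hp hq
      have := hφ hp.1 hq.1 ((hE.existsUnique _ hp.2.2).unique hp.2.1 (hpq ▸ hq.2.1))
      exact Sigma.ext this (heq_of_eq hpq)
  simp only [card_sigma, card_powersetCard, hE.card_eq, sum_const, smul_eq_mul] at h
  have := hY.card_pos
  by_contra! hlt
  interval_cases #Y <;> simp [Nat.choose] at h

variable [DecidableEq V] {u v o a : V}

lemma existsUnique_mem (hE : IsSteinerQuadruple E) {x y z : V} (hxy : x ≠ y) (hxz : x ≠ z)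
    (hyz : y ≠ z) : ∃! i, x ∈ E i ∧ y ∈ E i ∧ z ∈ E i := by
  simpa [Finset.insert_subset_iff] using
    hE.existsUnique {x, y, z} (Finset.card_eq_three.2 ⟨x, y, z, hxy, hxz, hyz, rfl⟩)

variable [Fintype V] [Fintype ι]

lemma card_pair (hE : IsSteinerQuadruple E) (huv : u ≠ v) :
    2 * #{i | u ∈ E i ∧ v ∈ E i} + 2 = Fintype.card V := by
  have h := Finset.card_mul_eq_card_mul (m := 2) (n := 1) (fun i x => x ∈ E i)
    (s := ({i | u ∈ E i ∧ v ∈ E i} : Finset ι)) (t := (univ.erase u).erase v)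
    (fun i hi => by
      obtain ⟨hu, hv⟩ := (mem_filter.1 hi).2
      have : ((univ.erase u).erase v).bipartiteAbove (fun i x => x ∈ E i) i =
          ((E i).erase u).erase v := by
        ext x; simp [bipartiteAbove, and_assoc]
      rw [this, card_erase_of_mem (mem_erase.2 ⟨huv.symm, hv⟩), card_erase_of_mem hu, hE.card_eq])
    (fun x hx => by
      simp only [mem_erase, mem_univ, and_true] at hx
      obtain ⟨i, hi, hi'⟩ := hE.existsUnique_mem huv hx.2.symm hx.1.symm
      refine Finset.card_eq_one.2 ⟨i, Finset.ext fun j => ?_⟩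
      simp only [bipartiteBelow, mem_filter, mem_univ, true_and, mem_singleton]
      constructor
      · exact fun h => hi' j ⟨h.1.1, h.1.2, h.2⟩
      · rintro rfl; exact ⟨⟨hi.1, hi.2.1⟩, hi.2.2⟩)
  rw [card_erase_of_mem (mem_erase.2 ⟨huv.symm, mem_univ v⟩), card_erase_of_mem (mem_univ u),
    card_univ] at h
  have : 1 < Fintype.card V := Fintype.one_lt_card_iff.2 ⟨u, v, huv⟩
  omega

lemma card_vertex (hE : IsSteinerQuadruple E) (v : V) :
    6 * #{i | v ∈ E i} = (Fintype.card V - 1) * (Fintype.card V - 2) := by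
  have h := Finset.card_mul_eq_card_mul (m := 3) (n := (Fintype.card V - 2) / 2)
    (fun i x => x ∈ E i) (s := ({i | v ∈ E i} : Finset ι)) (t := univ.erase v)
    (fun i hi => by
      have : (univ.erase v).bipartiteAbove (fun i x => x ∈ E i) i = (E i).erase v := by
        ext x; simp [bipartiteAbove]
      rw [this, card_erase_of_mem (mem_filter.1 hi).2, hE.card_eq])
    (fun x hx => by
      have := hE.card_pair (ne_of_mem_erase hx).symm
      rw [bipartiteBelow, filter_filter]
      omega)
  rw [card_erase_of_mem (mem_univ v), card_univ] at h
  rcases Nat.lt_or_ge 1 (Fintype.card V) with h1 | h1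
  · obtain ⟨u, hu⟩ := Fintype.exists_ne_of_one_lt_card h1 v
    have := hE.card_pair hu
    obtain ⟨k, hk⟩ : ∃ k, Fintype.card V - 2 = 2 * k :=
      ⟨#{i | u ∈ E i ∧ v ∈ E i}, by omega⟩
    rw [hk, Nat.mul_div_cancel_left _ two_pos] at h
    rw [hk]
    linarith
  · rw [Nat.sub_eq_zero_of_le h1, zero_mul] at h ⊢
    omega

lemma card_mod_six (hE : IsSteinerQuadruple E) (huv : u ≠ v) :
    Fintype.card V % 6 = 2 ∨ Fintype.card V % 6 = 4 := by
  have h1 := hE.card_pair huv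
  have h2 := hE.card_vertex u
  obtain ⟨n, hn⟩ : ∃ n, Fintype.card V = n + 2 := ⟨_, h1.symm⟩
  rw [hn] at h1 h2 ⊢
  rw [Nat.add_sub_cancel, show n + 2 - 1 = n + 1 by omega] at h2
  have h3 : (n + 1) * n % 3 = 0 := by omega
  rw [Nat.mul_mod, Nat.add_mod] at h3
  have : n % 3 < 3 := Nat.mod_lt _ (by norm_num)
  have h4 : n % 3 ≠ 1 := fun h => by rw [h] at h3; norm_num at h3
  omega

/-- Distinct edges through `o` can be assigned to the other vertices. -/
lemma exists_star_matching [Nonempty ι] (hE : IsSteinerQuadruple E) (hV : 8 ≤ Fintype.card V)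
    (o : V) : ∃ e : V → ι, Set.InjOn e (univ.erase o : Finset V) ∧
      ∀ v ∈ univ.erase o, v ∈ E (e v) ∧ o ∈ E (e v) := by
  refine exists_injOn_of_degree (univ.erase o) (fun v i => v ∈ E i ∧ o ∈ E i) (k := 3)
    (by norm_num) (fun v hv => ?_) fun i => ?_
  · have := hE.card_pair (ne_of_mem_erase hv)
    omega
  · by_cases ho : o ∈ E i
    · have : {v ∈ univ.erase o | v ∈ E i ∧ o ∈ E i} = (E i).erase o := by
        ext x; simp [ho]
      rw [this, card_erase_of_mem ho, hE.card_eq]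
    · simp [ho]

/-- Distinct edges through `a` that avoid `o` can be assigned to the other vertices. -/
lemma exists_star_matching_avoiding [Nonempty ι] (hE : IsSteinerQuadruple E)
    (hV : 10 ≤ Fintype.card V) (hao : a ≠ o) :
    ∃ φ : V → ι, Set.InjOn φ ((univ.erase o).erase a : Finset V) ∧
      ∀ v ∈ (univ.erase o).erase a, v ∈ E (φ v) ∧ a ∈ E (φ v) ∧ o ∉ E (φ v) := by
  refine exists_injOn_of_degree _ (fun v i => v ∈ E i ∧ a ∈ E i ∧ o ∉ E i) (k := 3)
    (by norm_num) (fun v hv => ?_) fun i => ?_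
  · simp only [mem_erase, mem_univ, and_true] at hv
    have h1 := hE.card_pair hv.1
    obtain ⟨j, -, hj⟩ := hE.existsUnique_mem hv.1 hv.2 hao
    have h2 : #{i | (v ∈ E i ∧ a ∈ E i) ∧ o ∈ E i} ≤ 1 :=
      Finset.card_le_one_iff_subset_singleton.2 ⟨j, fun i hi => by
        simpa using hj i (by simpa [and_assoc] using hi)⟩
    have h3 := Finset.card_filter_add_card_filter_not (s := {i | v ∈ E i ∧ a ∈ E i})
      (fun i => o ∈ E i)
    simp only [filter_filter, and_assoc] at h2 h3
    omega
  · by_cases ha : a ∈ E i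
    · refine (Finset.card_le_card (t := (E i).erase a) fun x hx => ?_).trans ?_
      · simp only [mem_filter, mem_erase] at hx ⊢
        exact ⟨hx.1.1, hx.2.1⟩
      · rw [card_erase_of_mem ha, hE.card_eq]
    · simp [ha]

/-- In a system of order `8`, distinct edges that avoid `o` can be assigned to the vertices other
than `o`. -/
lemma exists_matching_avoiding [Nonempty ι] (hE : IsSteinerQuadruple E)
    (hV : Fintype.card V = 8) (o a : V) :
    ∃ φ : V → ι, Set.InjOn φ ((univ.erase o).erase a : Finset V) ∧
      ∀ v ∈ (univ.erase o).erase a, v ∈ E (φ v) ∧ o ∉ E (φ v) := by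
  refine exists_injOn_of_degree _ (fun v i => v ∈ E i ∧ o ∉ E i) (k := 4)
    (by norm_num) (fun v hv => ?_) fun i => ?_
  · simp only [mem_erase, mem_univ, and_true] at hv
    have h1 := hE.card_pair hv.2
    have h2 := hE.card_vertex v
    have h3 := Finset.card_filter_add_card_filter_not (s := {i | v ∈ E i}) (fun i => o ∈ E i)
    simp only [filter_filter] at h3
    rw [hV] at h1 h2
    omega
  · rw [← hE.card_eq i]
    exact Finset.card_le_card fun x hx => (mem_filter.1 hx).2.1

lemma hasSpanningEulerTour (hE : IsSteinerQuadruple E) (hV : 8 ≤ Fintype.card V) :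
    HasSpanningEulerTour E := by
  obtain ⟨a, o, hao⟩ := Fintype.one_lt_card_iff.1 (by omega : 1 < Fintype.card V)
  obtain ⟨b, hb⟩ : ∃ b, b ∉ ({a, o} : Finset V) :=
    Finset.exists_mem_notMem_of_card_lt_card (s := {a, o}) (t := univ)
      (by rw [Finset.card_pair hao, card_univ]; omega) |>.imp fun _ h => h.2
  simp only [mem_insert, mem_singleton, not_or] at hb
  have : Nonempty ι := ⟨(hE.existsUnique_mem hao (Ne.symm hb.1) (Ne.symm hb.2)).exists.choose⟩
  obtain ⟨φ, hφ, hmem, hF⟩ : ∃ φ : V → ι, Set.InjOn φ ((univ.erase o).erase a : Finset V) ∧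
      (∀ v ∈ (univ.erase o).erase a, v ∈ E (φ v) ∧ o ∉ E (φ v)) ∧
      ∀ Y ⊆ (univ.erase o).erase a, Y.Nonempty → ∃ v ∈ Y, ∃ y ∈ E (φ v), y ∉ Y := by
    rcases Nat.lt_or_ge (Fintype.card V) 10 with h | h
    · have hV8 : Fintype.card V = 8 := by
        have := hE.card_mod_six hao
        omega
      obtain ⟨φ, hφ, hmem⟩ := hE.exists_matching_avoiding hV8 o a
      refine ⟨φ, hφ, hmem, fun Y hY hne => ?_⟩
      by_contra! hcon
      have h7 := hE.seven_le_card hne (hφ.mono (by exact_mod_cast hY)) hcon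
      have := card_le_card hY
      rw [card_erase_of_mem (mem_erase.2 ⟨hao, mem_univ a⟩), card_erase_of_mem (mem_univ o),
        card_univ] at this
      omega
    · obtain ⟨φ, hφ, hmem⟩ := hE.exists_star_matching_avoiding h hao
      exact ⟨φ, hφ, fun v hv => ⟨(hmem v hv).1, (hmem v hv).2.2⟩, fun Y hY ⟨v, hv⟩ =>
        ⟨v, hv, a, (hmem v (hY hv)).2.1, fun ha => ne_of_mem_erase (hY ha) rfl⟩⟩
  obtain ⟨s, t, hst, hconn⟩ := exists_connecting_choice
    (fun i => by rw [hE.card_eq]; norm_num) hφ hmem hF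
  obtain ⟨e, he, hmem_e⟩ := hE.exists_star_matching hV o
  exact hasSpanningEulerTour_of_connecting_choice hao he hmem_e hE.card_eq hst hconn

lemma eight_le_card (hE : IsSteinerQuadruple E) (hinj : Function.Injective E)
    (W : ClosedWalk E) (hW : IsEulerTour E W) : 8 ≤ Fintype.card V := by
  have hmod := hE.card_mod_six (W.vtx_ne 0)
  by_contra! hlt
  have h4 : 4 ≤ Fintype.card V := hE.card_eq (W.edg 0) ▸ card_le_univ _
  have huniv (i : ι) : E i = univ := by
    rw [← card_eq_iff_eq_univ, hE.card_eq]
    omega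
  have h01 : (0 : ZMod W.len) + 1 = 0 :=
    (hW (W.edg 0)).unique (hinj ((huniv _).trans (huniv _).symm)) rfl
  have := W.vtx_ne 0
  rw [h01] at this
  exact this rfl

end IsSteinerQuadruple

/-- **Corollary 1.6.** A Steiner quadruple system of order `n` (an `n`-vertex `4`-uniform
hypergraph without repeated edges in which every `3`-element vertex subset lies in exactly
one edge) has a spanning Euler tour if and only if `n ≥ 8` and `n ≡ 2, 4 (mod 6)`. -/
theorem sqs_hasSpanningEulerTour_iff {V ι : Type*} [Fintype V] [Fintype ι] [DecidableEq V]
    (E : ι → Finset V) (hinj : Function.Injective E)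
    (hunif : ∀ i, (E i).card = 4)
    (hsteiner : ∀ T : Finset V, T.card = 3 → ∃! i, T ⊆ E i) :
    HasSpanningEulerTour E ↔
      8 ≤ Fintype.card V ∧ (Fintype.card V % 6 = 2 ∨ Fintype.card V % 6 = 4) := by
  have hE : IsSteinerQuadruple E := ⟨hunif, hsteiner⟩
  constructor
  · rintro ⟨W, hW, -⟩
    exact ⟨hE.eight_le_card hinj W hW, hE.card_mod_six (W.vtx_ne 0)⟩
  · exact fun h => hE.hasSpanningEulerTour h.1
end

section
/- For every finite set K of integers with min K ≥ 3 and every integer λ ≥ max K, there exists an integer N = N(K,λ) such that every (v,K,λ)-pairwise balanced design with v ≥ N admits a spanning Euler tour (i.e., a spanning universal cycle of rank two). -/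
open Finset

/-- `IsTrail p u l v`: the list `l` of edge indices is a walk from `u` to `v` in the
multigraph whose edge with index `e` is the pair `p e`. -/
inductive IsTrail {V ι : Type*} [DecidableEq V] (p : ι → Finset V) : V → List ι → V → Prop
  | nil (u : V) : IsTrail p u [] u
  | cons {u w v : V} {e : ι} {l : List ι} (he : p e = {u, w}) (h : IsTrail p w l v) :
      IsTrail p u (e :: l) v

namespace IsTrail

variable {V ι : Type*} [DecidableEq V] {p : ι → Finset V} {u v w : V} {l m : List ι}

theorem append (h : IsTrail p u l v) (h' : IsTrail p v m w) : IsTrail p u (l ++ m) w := by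
  induction h with
  | nil u => exact h'
  | cons he _ ih => exact .cons he (ih h')

theorem concat (h : IsTrail p u l v) {e : ι} (he : p e = {v, w}) :
    IsTrail p u (l ++ [e]) w :=
  h.append (.cons he (.nil w))

theorem exists_split (h : IsTrail p u l v) {e : ι} (he : e ∈ l) {y : V} (hy : y ∈ p e) :
    ∃ l₁ l₂, l = l₁ ++ l₂ ∧ IsTrail p u l₁ y ∧ IsTrail p y l₂ v := by
  induction h with
  | nil u => simp at he
  | @cons u w v e' l he' h ih =>
    rcases List.mem_cons.1 he with rfl | he
    · rw [he'] at hy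
      rcases Finset.mem_insert.1 hy with rfl | hy
      · exact ⟨[], _, rfl, .nil _, .cons he' h⟩
      · rw [Finset.mem_singleton] at hy
        subst hy
        exact ⟨[e], l, rfl, .cons he' (.nil _), h⟩
    · obtain ⟨l₁, l₂, rfl, h₁, h₂⟩ := ih he
      exact ⟨e' :: l₁, l₂, rfl, .cons he' h₁, h₂⟩

/-- The number of edges of a trail at `x` is odd exactly when `x` is one of its two
different ends. -/
theorem even_countP_iff (hp : ∀ e, (p e).card = 2) (h : IsTrail p u l v) (x : V) :
    Even (l.countP (fun e => x ∈ p e)) ↔ (x = u ↔ x = v) := by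
  induction h with
  | nil u => simp
  | @cons u w v e l he h ih =>
    have huw : u ≠ w := by
      rintro rfl
      have := hp e
      simp [he] at this
    rw [List.countP_cons]
    by_cases hxu : x = u
    · subst hxu
      simp [he, Nat.even_add_one, ih, huw]
    · by_cases hxw : x = w
      · subst hxw
        simp [he, Nat.even_add_one, ih, hxu]
      · simp [he, ih, hxu, hxw]

theorem exists_vertex_sequence (h : IsTrail p u l v) :
    ∃ g : ℕ → V, g 0 = u ∧ g l.length = v ∧
      ∀ i (hi : i < l.length), p l[i] = {g i, g (i + 1)} := by
  induction h with
  | nil u => exact ⟨fun _ => u, rfl, rfl, by simp⟩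
  | @cons u w v e l he h ih =>
    obtain ⟨g, h0, hl, hg⟩ := ih
    refine ⟨fun n => Nat.casesOn n u g, rfl, hl, ?_⟩
    rintro (_ | i) hi
    · simpa [h0] using he
    · simpa using hg i (by simpa using hi)

theorem exists_edge_not_mem [Fintype ι] (hp : ∀ e, (p e).card = 2)
    (heven : ∀ x, Even (univ.filter (fun e => x ∈ p e)).card)
    (h : IsTrail p u l v) (hl : l.Nodup) {x : V} (hx : ¬ (x = u ↔ x = v)) :
    ∃ e, e ∉ l ∧ x ∈ p e := by
  classical
  by_contra! hc
  refine hx ((h.even_countP_iff hp x).1 ?_)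
  have : (l.filter (fun e => x ∈ p e)).toFinset = univ.filter (fun e => x ∈ p e) := by
    ext e
    have := hc e
    simp
    tauto
  rw [List.countP_eq_length_filter, ← List.toFinset_card_of_nodup (hl.filter _), this]
  exact heven x

end IsTrail

theorem exists_eq_pair_of_mem {V : Type*} [DecidableEq V] {s : Finset V} (hs : s.card = 2)
    {x : V} (hx : x ∈ s) : ∃ w, w ≠ x ∧ s = {x, w} := by
  obtain ⟨a, b, hab, rfl⟩ := Finset.card_eq_two.1 hs
  rcases Finset.mem_insert.1 hx with rfl | hx
  · exact ⟨b, hab.symm, rfl⟩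
  · rw [Finset.mem_singleton] at hx
    subst hx
    exact ⟨a, hab, Finset.pair_comm _ _⟩

/-- Euler's theorem for multigraphs: a connected multigraph with all degrees even has a
closed trail through all of its edges. -/
theorem exists_eulerian_trail {V ι : Type*} [DecidableEq V] [Nonempty V] [Fintype ι]
    {p : ι → Finset V} (hp : ∀ e, (p e).card = 2)
    (heven : ∀ x, Even (univ.filter (fun e => x ∈ p e)).card)
    (hconn : ∀ S : Set V, S.Nonempty → (∀ e, ∀ a ∈ p e, ∀ b ∈ p e, a ∈ S → b ∈ S) →
      S = Set.univ) :
    ∃ u l, IsTrail p u l u ∧ l.Nodup ∧ ∀ e, e ∈ l := by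
  classical
  obtain ⟨u, v, l, h, hl, hmax⟩ : ∃ u v l, IsTrail p u l v ∧ l.Nodup ∧
      ∀ u' v' l', IsTrail p u' l' v' → l'.Nodup → l'.length ≤ l.length := by
    let P : ℕ → Prop := fun n => ∃ u v l, IsTrail p u l v ∧ l.Nodup ∧ l.length = n
    have hP0 : P 0 := ⟨Classical.arbitrary V, _, [], .nil _, List.nodup_nil, rfl⟩
    obtain ⟨u, v, l, h, hl, hlen⟩ := Nat.findGreatest_spec (Nat.zero_le (Fintype.card ι)) hP0
    refine ⟨u, v, l, h, hl, fun u' v' l' h' hl' => ?_⟩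
    rw [hlen]
    exact Nat.le_findGreatest hl'.length_le_card ⟨u', v', l', h', hl', rfl⟩
  have huv : u = v := by
    by_contra huv
    obtain ⟨e, hel, hue⟩ := h.exists_edge_not_mem hp heven hl (x := u) (by simpa using huv)
    obtain ⟨w, -, hw⟩ := exists_eq_pair_of_mem (hp e) hue
    have := hmax w v (e :: l) (.cons (by rw [hw, Finset.pair_comm]) h)
      (List.nodup_cons.2 ⟨hel, hl⟩)
    simp at this
  subst huv
  have key : ∀ y, (y = u ∨ ∃ e ∈ l, y ∈ p e) → ∀ e, y ∈ p e → e ∈ l := by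
    intro y hy e hye
    by_contra hel
    obtain ⟨l₁, l₂, rfl, h₁, h₂⟩ :
        ∃ l₁ l₂, l = l₁ ++ l₂ ∧ IsTrail p u l₁ y ∧ IsTrail p y l₂ u := by
      rcases hy with rfl | ⟨e', he', hy'⟩
      · exact ⟨[], l, rfl, .nil _, h⟩
      · exact h.exists_split he' hy'
    obtain ⟨w, -, hw⟩ := exists_eq_pair_of_mem (hp e) hye
    have := hmax w y (e :: (l₂ ++ l₁)) (.cons (by rw [hw, Finset.pair_comm]) (h₂.append h₁))
      (List.nodup_cons.2 ⟨by simpa [or_comm] using hel, List.nodup_append_comm.1 hl⟩)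
    simp at this
    omega
  refine ⟨u, l, h, hl, fun e => ?_⟩
  have huniv := hconn {y | y = u ∨ ∃ e ∈ l, y ∈ p e} ⟨u, Or.inl rfl⟩
    (fun e a ha b hb haS => Or.inr ⟨e, key a haS e ha, hb⟩)
  obtain ⟨y, hy⟩ : (p e).Nonempty := by
    rw [← Finset.card_pos, hp e]
    norm_num
  exact key y (huniv.symm ▸ Set.mem_univ y : y ∈ {y | y = u ∨ ∃ e ∈ l, y ∈ p e}) e hy

/-- A hypergraph has a spanning Euler tour as soon as one can choose a pair inside every edge
so that the resulting multigraph is connected, spanning and even. -/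
theorem hasSpanningEulerTour_of_pairs {V ι : Type*} [DecidableEq V] [Nontrivial V] [Fintype ι]
    {E p : ι → Finset V} (hpE : ∀ e, p e ⊆ E e) (hp : ∀ e, (p e).card = 2)
    (heven : ∀ x, Even (univ.filter (fun e => x ∈ p e)).card)
    (hconn : ∀ S : Set V, S.Nonempty → (∀ e, ∀ a ∈ p e, ∀ b ∈ p e, a ∈ S → b ∈ S) →
      S = Set.univ) :
    HasSpanningEulerTour E := by
  obtain ⟨u, l, h, hl, hall⟩ := exists_eulerian_trail hp heven hconn
  have hcover : ∀ x : V, ∃ e, x ∈ p e := by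
    intro x
    by_contra! hx
    obtain ⟨y, hy⟩ := exists_ne x
    have : ({x} : Set V) = Set.univ := hconn {x} ⟨x, rfl⟩ fun e a ha b _ haS =>
      (hx e (Set.mem_singleton_iff.1 haS ▸ ha)).elim
    exact hy (this.symm ▸ Set.mem_univ y : y ∈ ({x} : Set V))
  obtain ⟨g, hg0, hgl, hg⟩ := h.exists_vertex_sequence
  have hpos : 0 < l.length := by
    obtain ⟨e, -⟩ := hcover u
    exact List.length_pos_of_mem (hall e)
  have : NeZero l.length := ⟨hpos.ne'⟩
  have hsucc : ∀ i : ZMod l.length, g (i + 1).val = g (i.val + 1) := by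
    intro i
    have hi := ZMod.val_lt i
    rw [ZMod.val_add, ZMod.val_one_eq_one_mod, Nat.add_mod_mod]
    rcases Nat.lt_or_ge (i.val + 1) l.length with hlt | hge
    · rw [Nat.mod_eq_of_lt hlt]
    · have : i.val + 1 = l.length := by omega
      rw [this, Nat.mod_self, hg0, hgl]
  have hpair : ∀ i : ZMod l.length, p (l[i.val]'(ZMod.val_lt i)) = {g i.val, g (i + 1).val} :=
    fun i => by rw [hsucc]; exact hg _ _
  have hedge : ∀ e, ∃ i : ZMod l.length, l[i.val]'(ZMod.val_lt i) = e := by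
    intro e
    obtain ⟨n, hn, rfl⟩ := List.getElem_of_mem (hall e)
    exact ⟨(n : ZMod l.length), by simp [ZMod.val_natCast, Nat.mod_eq_of_lt hn]⟩
  refine ⟨⟨l.length, hpos, fun i => g i.val, fun i => l[i.val]'(ZMod.val_lt i),
    fun i => hpE _ (by simp [hpair]), fun i => hpE _ (by simp [hpair]), fun i hi => ?_⟩,
    fun e => ?_, fun x => ?_⟩
  · have := hp (l[i.val]'(ZMod.val_lt i))
    rw [hpair, ← hi] at this
    simp at this
  · obtain ⟨i, hi⟩ := hedge e
    refine ⟨i, hi, fun j hj => ZMod.val_injective _ ?_⟩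
    exact (hl.getElem_inj_iff).1 (hj.trans hi.symm)
  · obtain ⟨e, he⟩ := hcover x
    obtain ⟨i, rfl⟩ := hedge e
    rw [hpair] at he
    rcases Finset.mem_insert.1 he with rfl | he
    · exact ⟨i, rfl⟩
    · exact ⟨i + 1, (Finset.mem_singleton.1 he).symm⟩

/-- Given a choice `q` of pairs and a system of distinct edges `f z ∋ x, z` for `z ≠ x`, one can
change `q` on the edges `f z` only so that all degrees become even. -/
theorem exists_even_pairs {V ι : Type*} [Fintype V] [DecidableEq V] [Fintype ι]
    {E q : ι → Finset V} (hE : ∀ e, 3 ≤ (E e).card)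
    (hqE : ∀ e, q e ⊆ E e) (hq : ∀ e, (q e).card = 2)
    {x : V} {f : V → ι} (hf : Function.Injective f) (hfx : ∀ z, x ∈ E (f z))
    (hfz : ∀ z, z ∈ E (f z)) :
    ∃ p : ι → Finset V, (∀ e, p e ⊆ E e) ∧ (∀ e, (p e).card = 2) ∧
      (∀ e, (∀ z, z ≠ x → f z ≠ e) → p e = q e) ∧
      ∀ z, Even (univ.filter (fun e => z ∈ p e)).card := by
  classical
  have hthird : ∀ z, ∃ a, a ∈ E (f z) ∧ a ≠ x ∧ a ≠ z := by
    intro z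
    obtain ⟨a, ha, ha'⟩ := Finset.exists_mem_notMem_of_card_lt_card
      (lt_of_le_of_lt (Finset.card_le_two (a := x) (b := z)) (hE (f z)))
    exact ⟨a, ha, by simp at ha'; tauto, by simp at ha'; tauto⟩
  choose a haE hax haz using hthird
  let p (T : V → Prop) (e : ι) : Finset V :=
    if h : ∃ z, z ≠ x ∧ f z = e then {a h.choose, if T h.choose then h.choose else x} else q e
  have hpf : ∀ T z, z ≠ x → p T (f z) = {a z, if T z then z else x} := by
    intro T z hz
    have h : ∃ z', z' ≠ x ∧ f z' = f z := ⟨z, hz, rfl⟩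
    have hch : h.choose = z := hf h.choose_spec.2
    simp only [p]
    rw [dif_pos h, hch]
  have hpq : ∀ T e, (∀ z, z ≠ x → f z ≠ e) → p T e = q e := by
    intro T e h
    simp only [p]
    rw [dif_neg]
    rintro ⟨z, hz, hze⟩
    exact h z hz hze
  have hcases : ∀ e, (∃ z, z ≠ x ∧ f z = e) ∨ ∀ z, z ≠ x → f z ≠ e := by
    intro e
    by_cases h : ∃ z, z ≠ x ∧ f z = e
    · exact Or.inl h
    · exact Or.inr (by push Not at h; exact h)
  have hpE : ∀ T e, p T e ⊆ E e := by
    intro T e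
    rcases hcases e with ⟨z, hz, rfl⟩ | h
    · rw [hpf T z hz, Finset.insert_subset_iff, Finset.singleton_subset_iff]
      refine ⟨haE z, ?_⟩
      split_ifs
      exacts [hfz z, hfx z]
    · rw [hpq T e h]
      exact hqE e
  have hp : ∀ T e, (p T e).card = 2 := by
    intro T e
    rcases hcases e with ⟨z, hz, rfl⟩ | h
    · rw [hpf T z hz, Finset.card_pair]
      split_ifs
      exacts [haz z, hax z]
    · rw [hpq T e h]
      exact hq e
  let T : V → Prop := fun z => ¬ Even (univ.filter (fun e => z ∈ p (fun _ => False) e)).card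
  have hmem : ∀ z, z ≠ x → ∀ e,
      z ∈ p T e ↔ z ∈ p (fun _ => False) e ∨ (e = f z ∧ T z) := by
    intro z hz e
    rcases hcases e with ⟨z', hz', rfl⟩ | h
    · rw [hpf T z' hz', hpf (fun _ => False) z' hz']
      by_cases hzz : z = z'
      · subst hzz
        by_cases hT : T z <;> simp [hT, hz]
      · have : f z' ≠ f z := fun h => hzz (hf h).symm
        by_cases hT : T z' <;> simp [hT, hz, hzz, this]
    · rw [hpq T e h, hpq (fun _ => False) e h]
      have : e ≠ f z := fun h' => h z hz h'.symm
      simp [this]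
  have hne : ∀ z, z ≠ x → Even (univ.filter (fun e => z ∈ p T e)).card := by
    intro z hz
    by_cases hT : T z
    · have : univ.filter (fun e => z ∈ p T e) =
          insert (f z) (univ.filter (fun e => z ∈ p (fun _ => False) e)) := by
        ext e
        simp [hmem z hz, hT, or_comm]
      rw [this, Finset.card_insert_of_notMem, Nat.even_add_one]
      · exact hT
      · simp [hpf _ z hz, hz, (haz z).symm]
    · have : univ.filter (fun e => z ∈ p T e) =
          univ.filter (fun e => z ∈ p (fun _ => False) e) := by
        ext e
        simp [hmem z hz, hT]
      rw [this]
      exact not_not.1 hT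
  refine ⟨p T, hpE T, hp T, hpq T, fun z => ?_⟩
  by_cases hz : z = x
  · subst hz
    have hsum : ∑ y, (univ.filter (fun e => y ∈ p T e)).card = ∑ e, (p T e).card := by
      have := Finset.sum_card_bipartiteAbove_eq_sum_card_bipartiteBelow
        (s := (univ : Finset V)) (t := (univ : Finset ι)) (fun y e => y ∈ p T e)
      simpa [Finset.bipartiteAbove, Finset.bipartiteBelow] using this
    rw [← Finset.add_sum_erase _ _ (Finset.mem_univ z)] at hsum
    have h1 : Even (∑ e, (p T e).card) := Finset.even_sum _ fun e _ => by simp [hp T e]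
    have h2 : Even (∑ y ∈ univ.erase z, (univ.filter (fun e => y ∈ p T e)).card) :=
      Finset.even_sum _ fun y hy => hne y (Finset.ne_of_mem_erase hy)
    rw [← hsum, Nat.even_add] at h1
    exact h1.2 h2
  · exact hne z hz

/-- Hall's theorem under the usual degree condition. -/
theorem exists_injective_of_degree_le {α ι : Type*} [Fintype α] [DecidableEq ι]
    {d : ℕ} (hd : 0 < d) (C : α → Finset ι) (hC : ∀ a, d ≤ (C a).card)
    (hdeg : ∀ e, (univ.filter (fun a => e ∈ C a)).card ≤ d) :
    ∃ f : α → ι, Function.Injective f ∧ ∀ a, f a ∈ C a := by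
  rw [← Finset.all_card_le_biUnion_card_iff_exists_injective]
  intro s
  refine Nat.le_of_mul_le_mul_right ?_ hd
  refine Finset.card_mul_le_card_mul (fun a e => e ∈ C a) (fun a ha => ?_) fun e _ => ?_
  · refine (hC a).trans (Finset.card_le_card fun e he => ?_)
    simp only [Finset.bipartiteAbove, Finset.mem_filter, Finset.mem_biUnion]
    exact ⟨⟨a, ha, he⟩, he⟩
  · refine (Finset.card_le_card fun a ha => ?_).trans (hdeg e)
    simp only [Finset.bipartiteBelow, Finset.mem_filter] at ha
    simpa using ha.2

/-- Given a parent function `par` with root `y` and distinct edges `t z` containing `z` and its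
parent, one can choose a pair in every edge such that the pair in `t z` is `{z, par z}`. -/
theorem exists_pairs_of_parent {V ι : Type*} [DecidableEq V] {E : ι → Finset V}
    (hE : ∀ e, 3 ≤ (E e).card) {y : V} {par : V → V} {t : V → ι}
    (ht : Set.InjOn t {y}ᶜ) (hz : ∀ z ≠ y, z ∈ E (t z)) (hpar : ∀ z ≠ y, par z ∈ E (t z))
    (hne : ∀ z ≠ y, par z ≠ z) :
    ∃ q : ι → Finset V, (∀ e, q e ⊆ E e) ∧ (∀ e, (q e).card = 2) ∧
      ∀ z ≠ y, q (t z) = {z, par z} := by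
  classical
  have hex : ∀ e, ∃ s : Finset V, s ⊆ E e ∧ s.card = 2 ∧ ∀ z ≠ y, t z = e → s = {z, par z} := by
    intro e
    by_cases h : ∃ z, z ≠ y ∧ t z = e
    · obtain ⟨z, hzy, rfl⟩ := h
      refine ⟨{z, par z}, ?_, Finset.card_pair (hne z hzy).symm, fun z' hz' h => ?_⟩
      · rw [Finset.insert_subset_iff, Finset.singleton_subset_iff]
        exact ⟨hz z hzy, hpar z hzy⟩
      · rw [ht hz' hzy h]
    · obtain ⟨s, hs, hs2⟩ := Finset.exists_subset_card_eq ((by norm_num : 2 ≤ 3).trans (hE e))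
      exact ⟨s, hs, hs2, fun z hz h' => (h ⟨z, hz, h'⟩).elim⟩
  choose q h1 h2 h3 using hex
  exact ⟨q, h1, h2, fun z hz => h3 _ z hz rfl⟩

section Design

variable {V ι : Type*} [DecidableEq V] [Fintype ι] {E : ι → Finset V} {k lam : ℕ}

/-- The union of all edges through two given vertices. -/
def lineUnion (E : ι → Finset V) (a b : V) : Finset V :=
  (univ.filter (fun i => a ∈ E i ∧ b ∈ E i)).biUnion E

theorem mem_lineUnion {a b w : V} :
    w ∈ lineUnion E a b ↔ ∃ i, a ∈ E i ∧ b ∈ E i ∧ w ∈ E i := by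
  simp [lineUnion, and_assoc]

theorem card_lineUnion_le (hk : ∀ i, (E i).card ≤ k)
    (hpair : ∀ a b, a ≠ b → (univ.filter (fun i => a ∈ E i ∧ b ∈ E i)).card = lam)
    {a b : V} (hab : a ≠ b) : (lineUnion E a b).card ≤ lam * k := by
  rw [← hpair a b hab]
  exact Finset.card_biUnion_le_card_mul _ _ _ fun i _ => hk i

theorem exists_edge_of_ne
    (hpair : ∀ a b, a ≠ b → (univ.filter (fun i => a ∈ E i ∧ b ∈ E i)).card = lam)
    (hlam : 0 < lam) {a b : V} (hab : a ≠ b) : ∃ i, a ∈ E i ∧ b ∈ E i := by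
  rw [← hpair a b hab, Finset.card_pos] at hlam
  obtain ⟨i, hi⟩ := hlam
  exact ⟨i, by simpa using hi⟩

/-- A vertex `z` of a small set `B` lies in an edge meeting `B` in `z` only. -/
theorem exists_edge_inter_eq [Fintype V] (hk : ∀ i, (E i).card ≤ k)
    (hpair : ∀ a b, a ≠ b → (univ.filter (fun i => a ∈ E i ∧ b ∈ E i)).card = lam)
    (hlam : 0 < lam) {B : Finset V} (hB : B.card + B.card * (lam * k) < Fintype.card V)
    {z : V} (hz : z ∈ B) :
    ∃ i, ∃ w, z ∈ E i ∧ w ∈ E i ∧ w ∉ B ∧ ∀ b ∈ B, b ∈ E i → b = z := by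
  have hcard : (B ∪ (B.erase z).biUnion (lineUnion E z)).card < Fintype.card V := by
    refine lt_of_le_of_lt ((Finset.card_union_le _ _).trans ?_) hB
    refine Nat.add_le_add_left ((Finset.card_biUnion_le_card_mul _ _ (lam * k) fun b hb => ?_).trans
      (Nat.mul_le_mul_right _ (Finset.card_le_card (Finset.erase_subset _ _)))) _
    exact card_lineUnion_le hk hpair (Finset.ne_of_mem_erase hb).symm
  obtain ⟨w, -, hw⟩ := Finset.exists_mem_notMem_of_card_lt_card
    (hcard.trans_eq (Finset.card_univ (α := V)).symm)
  rw [Finset.mem_union, not_or] at hw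
  obtain ⟨hwB, hw⟩ := hw
  obtain ⟨i, hzi, hwi⟩ := exists_edge_of_ne hpair hlam (a := z) (b := w)
    (fun h => hwB (h ▸ hz))
  refine ⟨i, w, hzi, hwi, hwB, fun b hb hbi => ?_⟩
  by_contra hbz
  exact hw (Finset.mem_biUnion.2
    ⟨b, Finset.mem_erase.2 ⟨hbz, hb⟩, mem_lineUnion.2 ⟨i, hzi, hbi, hwi⟩⟩)

/-- All vertices, including `x` itself, can be joined to `x` by distinct edges. -/
theorem exists_star [Fintype V] [Nontrivial V] (hk : ∀ i, (E i).card ≤ k) (hk0 : 0 < k)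
    (hklam : k ≤ lam)
    (hpair : ∀ a b, a ≠ b → (univ.filter (fun i => a ∈ E i ∧ b ∈ E i)).card = lam) (x : V) :
    ∃ f : V → ι, Function.Injective f ∧ ∀ z, x ∈ E (f z) ∧ z ∈ E (f z) := by
  classical
  have hC : ∀ z, k ≤ (univ.filter (fun i => x ∈ E i ∧ z ∈ E i)).card := by
    intro z
    refine hklam.trans ?_
    by_cases hz : z = x
    · subst hz
      obtain ⟨y, hy⟩ := exists_ne z
      rw [← hpair z y hy.symm]
      refine Finset.card_le_card fun i hi => ?_
      simp at hi ⊢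
      exact hi.1
    · exact (hpair x z (Ne.symm hz)).ge
  have hdeg : ∀ e, (univ.filter
      (fun z => e ∈ univ.filter (fun i => x ∈ E i ∧ z ∈ E i))).card ≤ k := by
    intro e
    refine (Finset.card_le_card fun z hz => ?_).trans (hk e)
    simp at hz
    exact hz.2
  obtain ⟨f, hf, hfC⟩ := exists_injective_of_degree_le hk0 _ hC hdeg
  exact ⟨f, hf, fun z => by simpa using hfC z⟩

theorem hasSpanningEulerTour_of_large [Fintype V] (h3 : ∀ i, 3 ≤ (E i).card) (hk : ∀ i, (E i).card ≤ k)
    (hk0 : 0 < k) (hklam : k ≤ lam)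
    (hpair : ∀ a b, a ≠ b → (univ.filter (fun i => a ∈ E i ∧ b ∈ E i)).card = lam)
    (hV : lam * k + lam * k * (lam * k) + 2 ≤ Fintype.card V) : HasSpanningEulerTour E := by
  classical
  have hlam : 0 < lam := hk0.trans_le hklam
  have : Nontrivial V := Fintype.one_lt_card_iff_nontrivial.1 (by omega)
  obtain ⟨x, y, hxy⟩ := exists_pair_ne V
  obtain ⟨f, hf, hfE⟩ := exists_star hk hk0 hklam hpair x
  obtain ⟨g, hg, hgE⟩ := exists_star hk hk0 hklam hpair y
  obtain ⟨B, hBdef⟩ : ∃ B, B = lineUnion E x y := ⟨_, rfl⟩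
  have hBcard : B.card ≤ lam * k := hBdef ▸ card_lineUnion_le hk hpair hxy
  have hmemB : ∀ {z}, z ∈ B ↔ ∃ i, x ∈ E i ∧ y ∈ E i ∧ z ∈ E i := by
    rw [hBdef]
    exact mem_lineUnion
  have hxyB : x ∈ B ∧ y ∈ B := by
    obtain ⟨i, hx, hy⟩ := exists_edge_of_ne hpair hlam hxy
    exact ⟨hmemB.2 ⟨i, hx, hy, hx⟩, hmemB.2 ⟨i, hx, hy, hy⟩⟩
  have hgx : ∀ z ∉ B, x ∉ E (g z) := fun z hz hx =>
    hz (hmemB.2 ⟨g z, hx, (hgE z).1, (hgE z).2⟩)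
  have hB : B.card + B.card * (lam * k) < Fintype.card V := by
    have := Nat.mul_le_mul_right (lam * k) hBcard
    omega
  have : Nonempty ι := ⟨f x⟩
  have hinner := fun z (hz : z ∈ B) => exists_edge_inter_eq hk hpair hlam hB hz
  choose! h w hzh hwh hwB hhB using hinner
  obtain ⟨c, hc, hcx⟩ := Finset.exists_mem_ne
    (Nat.lt_of_lt_of_le (by norm_num) (h3 (f x))) x
  let t : V → ι := fun z => if z = x then f x else if z ∈ B then h z else g z
  let par : V → V := fun z => if z = x then c else if z ∈ B then w z else y
  have htx : t x = f x := if_pos rfl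
  have htB : ∀ z, z ≠ x → z ∈ B → t z = h z := fun z h1 h2 => by simp [t, h1, h2]
  have htg : ∀ z, z ∉ B → t z = g z := fun z h2 => by
    have h1 : z ≠ x := fun h1 => h2 (h1 ▸ hxyB.1)
    simp [t, h1, h2]
  have hpx : par x = c := if_pos rfl
  have hpB : ∀ z, z ≠ x → z ∈ B → par z = w z := fun z h1 h2 => by simp [par, h1, h2]
  have hpg : ∀ z, z ∉ B → par z = y := fun z h2 => by
    have h1 : z ≠ x := fun h1 => h2 (h1 ▸ hxyB.1)
    simp [par, h1, h2]
  have hcases : ∀ z, z = x ∨ (z ≠ x ∧ z ∈ B) ∨ z ∉ B := fun z => by tauto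
  have htnx : ∀ z, z ≠ x → x ∉ E (t z) := by
    intro z hz hx
    rcases hcases z with rfl | ⟨hzx, hzB⟩ | hzB
    · exact hz rfl
    · rw [htB z hzx hzB] at hx
      exact hzx (hhB z hzB x hxyB.1 hx).symm
    · rw [htg z hzB] at hx
      exact hgx z hzB hx
  have hzt : ∀ z, z ∈ E (t z) := by
    intro z
    rcases hcases z with rfl | ⟨hzx, hzB⟩ | hzB
    · rw [htx]; exact (hfE _).1
    · rw [htB z hzx hzB]; exact hzh z hzB
    · rw [htg z hzB]; exact (hgE z).2
  have hpt : ∀ z, par z ∈ E (t z) := by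
    intro z
    rcases hcases z with rfl | ⟨hzx, hzB⟩ | hzB
    · rw [htx, hpx]; exact hc
    · rw [htB z hzx hzB, hpB z hzx hzB]; exact hwh z hzB
    · rw [htg z hzB, hpg z hzB]; exact (hgE z).1
  have hpne : ∀ z, par z ≠ z := by
    intro z hz
    rcases hcases z with rfl | ⟨hzx, hzB⟩ | hzB
    · exact hcx (hpx.symm.trans hz)
    · rw [hpB z hzx hzB] at hz
      exact hwB z hzB (hz.symm ▸ hzB)
    · rw [hpg z hzB] at hz
      exact hzB (hz ▸ hxyB.2)
  have htinj : Set.InjOn t {y}ᶜ := by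
    have hmixed : ∀ z₁ z₂, z₁ ≠ x → z₁ ≠ y → z₁ ∈ B → z₂ ∉ B → t z₁ ≠ t z₂ := by
      intro z₁ z₂ h1 h2 h3 h4 heq
      rw [htB z₁ h1 h3, htg z₂ h4] at heq
      exact h2 (hhB z₁ h3 y hxyB.2 (heq ▸ (hgE z₂).1)).symm
    intro z₁ hz₁ z₂ hz₂ heq
    rcases eq_or_ne z₁ x with h1 | h1 <;> rcases eq_or_ne z₂ x with h2 | h2
    · rw [h1, h2]
    · exact (htnx z₂ h2 (heq ▸ h1 ▸ hzt z₁)).elim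
    · exact (htnx z₁ h1 (heq ▸ h2 ▸ hzt z₂)).elim
    · by_cases hB1 : z₁ ∈ B <;> by_cases hB2 : z₂ ∈ B
      · rw [htB z₁ h1 hB1, htB z₂ h2 hB2] at heq
        exact hhB z₂ hB2 z₁ hB1 (heq ▸ hzh z₁ hB1)
      · exact (hmixed z₁ z₂ h1 hz₁ hB1 hB2 heq).elim
      · exact (hmixed z₂ z₁ h2 hz₂ hB2 hB1 heq.symm).elim
      · rw [htg z₁ hB1, htg z₂ hB2] at heq
        exact hg heq
  obtain ⟨q, hqE, hq2, hqt⟩ := exists_pairs_of_parent h3 htinj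
    (fun z _ => hzt z) (fun z _ => hpt z) (fun z _ => hpne z)
  obtain ⟨p, hpE, hp2, hpq, heven⟩ := exists_even_pairs h3 hqE hq2 hf
    (fun z => (hfE z).1) (fun z => (hfE z).2)
  have hptree : ∀ z ≠ y, p (t z) = {z, par z} := by
    intro z hzy
    rw [← hqt z hzy]
    refine hpq _ fun z' hz' heq => ?_
    by_cases hzx : z = x
    · subst hzx
      exact hz' (hf (heq.trans htx))
    · exact htnx z hzx (heq ▸ (hfE z').1)
  refine hasSpanningEulerTour_of_pairs hpE hp2 heven fun S hS hclosed => ?_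
  have hstep : ∀ z ≠ y, (z ∈ S ↔ par z ∈ S) := fun z hzy =>
    ⟨hclosed (t z) _ (by simp [hptree z hzy]) _ (by simp [hptree z hzy]),
      hclosed (t z) _ (by simp [hptree z hzy]) _ (by simp [hptree z hzy])⟩
  have hout : ∀ z ∉ B, (z ∈ S ↔ y ∈ S) := fun z hzB => by
    rw [hstep z fun h => hzB (h ▸ hxyB.2), hpg z hzB]
  have hmost : ∀ z, z ≠ x → (z ∈ S ↔ y ∈ S) := fun z hzx => by
    by_cases hzB : z ∈ B
    · by_cases hzy : z = y
      · rw [hzy]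
      · rw [hstep z hzy, hpB z hzx hzB, hout _ (hwB z hzB)]
    · exact hout z hzB
  have hroot : ∀ z, (z ∈ S ↔ y ∈ S) := fun z => by
    by_cases hzx : z = x
    · subst hzx
      rw [hstep z hxy, hpx, hmost c hcx]
    · exact hmost z hzx
  obtain ⟨s, hs⟩ := hS
  exact Set.eq_univ_of_forall fun z => (hroot z).2 ((hroot s).1 hs)

end Design

/-- **Corollary 1.8.** For every finite set `K` of integers with `min K ≥ 3` and every
integer `λ ≥ max K`, there is an `N = N(K, λ)` such that every `(v, K, λ)`-pairwise
balanced design (a `v`-vertex hypergraph in which every `2`-subset of vertices lies in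
exactly `λ` edges and all edge cardinalities belong to `K`) with `v ≥ N` admits a
spanning Euler tour (i.e. a spanning universal cycle of rank two). -/
theorem pbd_hasSpanningEulerTour (K : Finset ℕ) (hK : K.Nonempty) (hmin : 3 ≤ K.min' hK)
    (lam : ℕ) (hlam : K.max' hK ≤ lam) :
    ∃ N : ℕ, ∀ (V ι : Type) [Fintype V] [Fintype ι] [DecidableEq V] (E : ι → Finset V),
      (∀ i, (E i).card ∈ K) →
      (∀ T : Finset V, T.card = 2 →
        (Finset.univ.filter (fun i => T ⊆ E i)).card = lam) →
      N ≤ Fintype.card V →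
      HasSpanningEulerTour E := by
  refine ⟨lam * K.max' hK + lam * K.max' hK * (lam * K.max' hK) + 2, ?_⟩
  intro V ι _ _ _ E hE hpair hV
  have h3 := hmin.trans (K.min'_le_max' hK)
  refine hasSpanningEulerTour_of_large (fun i => hmin.trans (K.min'_le _ (hE i)))
    (fun i => K.le_max' _ (hE i)) (by omega) hlam (fun a b hab => ?_) hV
  have := hpair {a, b} (Finset.card_pair hab)
  simpa [Finset.insert_subset_iff] using this
end

section
/- Let G be a bipartite graph with parts X and Y, and let S ⊆ X and T ⊆ X ∪ Y with S ∩ T = ∅. Then δ(S,T) = 2|S| + Σ_{v∈T} deg_{G−S}(v) − 2|T ∩ X| − q(S,T) is an even integer. -/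
open Finset SimpleGraph

attribute [local instance] Classical.propDecidable

/-- The degree of `v` in `G − S`, the graph obtained from `G` by deleting the vertices
of `S` (and all incident edges): the number of neighbors of `v` outside `S`. -/
noncomputable def degDel {V : Type*} (G : SimpleGraph V) (S : Finset V) (v : V) : ℕ :=
  Nat.card {w : V // G.Adj v w ∧ w ∉ S}

/-- The graph `G − R` obtained by deleting the vertices of `R`, as a graph on the
subtype of vertices not in `R`. -/
def delGraph {V : Type*} (G : SimpleGraph V) (R : Finset V) :
    SimpleGraph {v : V // v ∉ R} :=
  G.comap Subtype.val

/-- `ε_G(T, C)`: the number of edges of `G` with one endpoint in `T` and the other in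
the connected component `C` of `G − (S ∪ T)`. -/
noncomputable def epsTC {V : Type*} [DecidableEq V] (G : SimpleGraph V) (S T : Finset V)
    (C : (delGraph G (S ∪ T)).ConnectedComponent) : ℕ :=
  Nat.card {p : V × {v : V // v ∉ S ∪ T} //
    p.1 ∈ T ∧ G.Adj p.1 p.2.1 ∧ (delGraph G (S ∪ T)).connectedComponentMk p.2 = C}

/-- `q(S, T)`: the number of `T`-odd components of `G − (S ∪ T)`, i.e. components `C`
with `ε_G(T, C)` odd. -/
noncomputable def qST {V : Type*} [DecidableEq V] (G : SimpleGraph V) (S T : Finset V) : ℕ :=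
  Nat.card {C : (delGraph G (S ∪ T)).ConnectedComponent // Odd (epsTC G S T C)}

/-- `δ(S, T) = 2|S| + Σ_{v ∈ T} deg_{G−S}(v) − 2|T ∩ X| − q(S, T)`, as an integer. -/
noncomputable def eulerDelta {V : Type*} [DecidableEq V] (G : SimpleGraph V)
    (X S T : Finset V) : ℤ :=
  2 * (S.card : ℤ) + (∑ v ∈ T, (degDel G S v : ℤ)) - 2 * ((T ∩ X).card : ℤ)
    - (qST G S T : ℤ)

/-- The ordered pairs of adjacent vertices inside `T` are even in number. -/
theorem even_sum_card_adj_inside {V : Type*} [Fintype V] [DecidableEq V] (G : SimpleGraph V)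
    (T : Finset V) : Even (∑ v ∈ T, #{w | G.Adj v w ∧ w ∈ T}) := by
  let H : SimpleGraph V :=
    { Adj := fun v w => G.Adj v w ∧ v ∈ T ∧ w ∈ T
      symm := ⟨fun _ _ h => ⟨h.1.symm, h.2.2, h.2.1⟩⟩
      loopless := ⟨fun _ h => G.irrefl h.1⟩ }
  have h : ∑ v ∈ T, #{w | G.Adj v w ∧ w ∈ T} = ∑ v, H.degree v := by
    rw [← Finset.sum_subset (Finset.subset_univ T)]
    · refine Finset.sum_congr rfl fun v hv => ?_
      rw [← SimpleGraph.card_neighborFinset_eq_degree]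
      congr 1
      ext w
      simp [H, hv]
    · intro v _ hv
      rw [← SimpleGraph.card_neighborFinset_eq_degree, Finset.card_eq_zero]
      ext w
      simp [H, hv]
  rw [h, H.sum_degrees_eq_twice_card_edges]
  exact even_two_mul _

/-- The edges between `T` and the vertices outside `S ∪ T`, counted by component. -/
theorem sum_epsTC {V : Type*} [Fintype V] [DecidableEq V] (G : SimpleGraph V)
    (S T : Finset V) :
    ∑ C, epsTC G S T C = ∑ v ∈ T, #{w | G.Adj v w ∧ w ∉ S ∪ T} := by
  have hl (C : (delGraph G (S ∪ T)).ConnectedComponent) : epsTC G S T C =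
      #{p ∈ ({p | p.1 ∈ T ∧ G.Adj p.1 p.2.1} : Finset (V × {v : V // v ∉ S ∪ T})) |
        (delGraph G (S ∪ T)).connectedComponentMk p.2 = C} := by
    rw [epsTC, Nat.card_eq_fintype_card, Fintype.card_subtype, Finset.filter_filter]
    congr 1
    ext p
    simp only [Finset.mem_filter, and_assoc]
  have hfib : ∑ C, epsTC G S T C =
      #({p | p.1 ∈ T ∧ G.Adj p.1 p.2.1} : Finset (V × {v : V // v ∉ S ∪ T})) := by
    rw [Finset.sum_congr rfl fun C _ => hl C, eq_comm]
    convert Finset.card_eq_sum_card_fiberwise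
      (f := fun p : V × {v : V // v ∉ S ∪ T} =>
        (delGraph G (S ∪ T)).connectedComponentMk p.2)
      fun _ _ => Finset.mem_coe.2 (Finset.mem_univ _)
  rw [hfib, ← Finset.card_sigma]
  refine Finset.card_bij (fun p _ => ⟨p.1, p.2.1⟩) ?_ ?_ ?_
  · rintro ⟨v, w, hw⟩ h
    simp only [Finset.mem_filter, Finset.mem_univ, true_and] at h
    simpa only [Finset.mem_sigma, Finset.mem_filter, Finset.mem_univ, true_and] using
      ⟨h.1, h.2, hw⟩
  · rintro ⟨v, w, hw⟩ _ ⟨v', w', hw'⟩ _ h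
    simpa using h
  · rintro ⟨v, w⟩ h
    simp only [Finset.mem_sigma, Finset.mem_filter, Finset.mem_univ, true_and] at h
    exact ⟨⟨v, w, h.2.2⟩, by simpa using ⟨h.1, h.2.1⟩, rfl⟩

/-- The number of `T`-odd components has the parity of the total number of edges between
`T` and the components of `G − (S ∪ T)`. -/
theorem even_qST_iff {V : Type*} [Fintype V] [DecidableEq V] (G : SimpleGraph V)
    (S T : Finset V) : Even (qST G S T) ↔ Even (∑ C, epsTC G S T C) := by
  rw [Finset.even_sum_iff_even_card_odd, qST, Nat.card_eq_fintype_card, Fintype.card_subtype]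

theorem degDel_eq_add {V : Type*} [Fintype V] [DecidableEq V] (G : SimpleGraph V)
    {S T : Finset V} (hST : Disjoint S T) (v : V) :
    degDel G S v = #{w | G.Adj v w ∧ w ∈ T} + #{w | G.Adj v w ∧ w ∉ S ∪ T} := by
  rw [degDel, Nat.card_eq_fintype_card, Fintype.card_subtype, ← Finset.card_union_of_disjoint]
  · congr 1
    ext w
    have : w ∈ S → w ∉ T := fun h => Finset.disjoint_left.1 hST h
    simp only [Finset.mem_filter, Finset.mem_univ, true_and, Finset.mem_union]
    tauto
  · rw [Finset.disjoint_left]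
    intro w
    simp only [Finset.mem_filter, Finset.mem_univ, true_and, Finset.mem_union]
    tauto

/-- **Lemma 2.1.** For a finite bipartite graph `G` with parts `X`, `Y`, and `S ⊆ X`,
`T ⊆ X ∪ Y` with `S ∩ T = ∅`, the quantity
`δ(S,T) = 2|S| + Σ_{v∈T} deg_{G−S}(v) − 2|T ∩ X| − q(S,T)` is even. -/
theorem eulerDelta_even {V : Type*} [Fintype V] [DecidableEq V] (G : SimpleGraph V)
    (X Y S T : Finset V)
    (hpart : X ∪ Y = Finset.univ) (hXY : Disjoint X Y)
    (hbip : ∀ u v, G.Adj u v → (u ∈ X ↔ v ∈ Y))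
    (hS : S ⊆ X) (hT : T ⊆ X ∪ Y) (hST : Disjoint S T) :
    Even (eulerDelta G X S T) := by
  have h : Even (∑ v ∈ T, degDel G S v) ↔ Even (qST G S T) := by
    rw [Finset.sum_congr rfl fun v _ => degDel_eq_add G hST v, Finset.sum_add_distrib,
      even_qST_iff, sum_epsTC, Nat.even_add]
    exact iff_true_left (even_sum_card_adj_inside G T)
  rw [eulerDelta, ← Nat.cast_sum, Int.even_sub, Int.even_sub, Int.even_add, Int.even_coe_nat,
    Int.even_coe_nat, h]
  simp
end

section
/- Let G be a bipartite graph with parts X and Y, and let (S,T) be a minimum barrier of G. Then T ⊆ X. -/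
open Finset SimpleGraph

attribute [local instance] Classical.propDecidable

/-- `(S, T)` is a barrier of the bipartite graph `G` with parts `X`, `Y`:
`S ⊆ X`, `T ⊆ X ∪ Y`, `S ∩ T = ∅`, and `δ(S, T) < 0`. -/
def IsBarrier {V : Type*} [DecidableEq V] (G : SimpleGraph V) (X Y S T : Finset V) : Prop :=
  S ⊆ X ∧ T ⊆ X ∪ Y ∧ Disjoint S T ∧ eulerDelta G X S T < 0

/-- A minimum barrier: a barrier whose size `|S ∪ T|` is as small as possible. -/
def IsMinBarrier {V : Type*} [DecidableEq V] (G : SimpleGraph V) (X Y S T : Finset V) :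
    Prop :=
  IsBarrier G X Y S T ∧
    ∀ S' T' : Finset V, IsBarrier G X Y S' T' → (S ∪ T).card ≤ (S' ∪ T').card

/-- The inclusion `G − (S ∪ T) → G − (S ∪ (T \ {v}))`. -/
def delGraphEraseHom {V : Type*} [DecidableEq V] (G : SimpleGraph V) (S T : Finset V) (v : V) :
    delGraph G (S ∪ T) →g delGraph G (S ∪ T.erase v) where
  toFun x := ⟨x.1, fun h => x.2 (union_subset_union_right (erase_subset v T) h)⟩
  map_rel' h := h

/-- A component of `G − (S ∪ T)` with no neighbor of `v` is still a full component
when `v` is put back. -/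
theorem exists_mem_component_of_reachable {V : Type*} [DecidableEq V] (G : SimpleGraph V)
    (S T : Finset V) (v : V) (C : (delGraph G (S ∪ T)).ConnectedComponent)
    (hC : ∀ x : {x : V // x ∉ S ∪ T},
      (delGraph G (S ∪ T)).connectedComponentMk x = C → ¬ G.Adj v x)
    {a b : {x : V // x ∉ S ∪ T.erase v}} (p : (delGraph G (S ∪ T.erase v)).Walk a b)
    (ha : ∃ x, (delGraph G (S ∪ T)).connectedComponentMk x = C ∧
      delGraphEraseHom G S T v x = a) :
    ∃ x, (delGraph G (S ∪ T)).connectedComponentMk x = C ∧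
      delGraphEraseHom G S T v x = b := by
  induction p with
  | nil => exact ha
  | @cons a c b hac p ih =>
    apply ih
    obtain ⟨x, hx, rfl⟩ := ha
    have hadj : G.Adj x.1 c.1 := hac
    have hcv : c.1 ≠ v := fun h => hC x hx (h ▸ hadj.symm)
    have hc : c.1 ∉ S ∪ T := by
      have := c.2
      simp only [mem_union, mem_erase, not_or, not_and] at this ⊢
      exact ⟨this.1, this.2 hcv⟩
    refine ⟨⟨c.1, hc⟩, ?_, rfl⟩
    rw [← hx]
    exact ConnectedComponent.sound (Adj.reachable (G := delGraph G (S ∪ T)) hadj.symm)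

theorem map_eq_mk_iff {V : Type*} [DecidableEq V] (G : SimpleGraph V)
    (S T : Finset V) (v : V) (C : (delGraph G (S ∪ T)).ConnectedComponent)
    (hC : ∀ x : {x : V // x ∉ S ∪ T},
      (delGraph G (S ∪ T)).connectedComponentMk x = C → ¬ G.Adj v x)
    (b : {x : V // x ∉ S ∪ T.erase v}) :
    (delGraph G (S ∪ T.erase v)).connectedComponentMk b = C.map (delGraphEraseHom G S T v) ↔
      ∃ x, (delGraph G (S ∪ T)).connectedComponentMk x = C ∧
        delGraphEraseHom G S T v x = b := by
  constructor
  · induction C using ConnectedComponent.ind with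
    | h a =>
      intro h
      obtain ⟨p⟩ := ConnectedComponent.exact h.symm
      exact exists_mem_component_of_reachable G S T v _ hC p ⟨a, rfl, rfl⟩
  · rintro ⟨x, rfl, rfl⟩
    rfl

theorem delGraphEraseHom_injective {V : Type*} [DecidableEq V] (G : SimpleGraph V)
    (S T : Finset V) (v : V) : Function.Injective (delGraphEraseHom G S T v) :=
  fun x y h => Subtype.ext
    (show (delGraphEraseHom G S T v x).1 = (delGraphEraseHom G S T v y).1 by rw [h])

theorem epsTC_map_erase {V : Type*} [DecidableEq V] (G : SimpleGraph V)
    (S T : Finset V) (v : V) (C : (delGraph G (S ∪ T)).ConnectedComponent)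
    (hC : ∀ x : {x : V // x ∉ S ∪ T},
      (delGraph G (S ∪ T)).connectedComponentMk x = C → ¬ G.Adj v x) :
    epsTC G S (T.erase v) (C.map (delGraphEraseHom G S T v)) = epsTC G S T C := by
  symm
  refine Nat.card_congr (Equiv.ofBijective
    (fun p => ⟨(p.1.1, delGraphEraseHom G S T v p.1.2), ?_, p.2.2.1, ?_⟩) ⟨?_, ?_⟩)
  · exact mem_erase.2 ⟨fun h => hC _ p.2.2.2 (h ▸ p.2.2.1), p.2.1⟩
  · exact (map_eq_mk_iff G S T v C hC _).2 ⟨_, p.2.2.2, rfl⟩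
  · rintro ⟨⟨t, x⟩, hp⟩ ⟨⟨t', x'⟩, hp'⟩ h
    simp only [Subtype.mk.injEq, Prod.mk.injEq] at h
    obtain ⟨rfl, h⟩ := h
    obtain rfl := delGraphEraseHom_injective G S T v h
    rfl
  · rintro ⟨⟨t, y⟩, ht, hty, hy⟩
    obtain ⟨x, hx, rfl⟩ := (map_eq_mk_iff G S T v C hC y).1 hy
    exact ⟨⟨(t, x), mem_of_mem_erase ht, hty, hx⟩, rfl⟩

/-- Removing `v` from `T` decreases the number of odd components by at most
the degree of `v` in `G − S`. -/
theorem qST_le_degDel_add {V : Type*} [Finite V] [DecidableEq V] (G : SimpleGraph V)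
    (S T : Finset V) (v : V) :
    qST G S T ≤ degDel G S v + qST G S (T.erase v) := by
  unfold qST degDel
  rw [← Nat.card_sum]
  let N (C : (delGraph G (S ∪ T)).ConnectedComponent) : Prop :=
    ∃ x : {x : V // x ∉ S ∪ T},
      (delGraph G (S ∪ T)).connectedComponentMk x = C ∧ G.Adj v x
  have hN (C) (h : ¬ N C) (x : {x : V // x ∉ S ∪ T})
      (hx : (delGraph G (S ∪ T)).connectedComponentMk x = C) : ¬ G.Adj v x :=
    fun hv => h ⟨x, hx, hv⟩
  have : Finite (delGraph G (S ∪ T.erase v)).ConnectedComponent :=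
    Quot.finite _
  let f (C : {C : (delGraph G (S ∪ T)).ConnectedComponent // Odd (epsTC G S T C)}) :
      {w : V // G.Adj v w ∧ w ∉ S} ⊕ {C : (delGraph G (S ∪ T.erase v)).ConnectedComponent //
        Odd (epsTC G S (T.erase v) C)} :=
    if h : N C.1 then
      .inl ⟨h.choose.1, h.choose_spec.2, fun hS => h.choose.2 (mem_union_left T hS)⟩
    else
      .inr ⟨C.1.map (delGraphEraseHom G S T v),
        (epsTC_map_erase G S T v C.1 (hN C.1 h)).symm ▸ C.2⟩
  refine Nat.card_le_card_of_injective f fun C D hCD => Subtype.ext ?_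
  by_cases hC : N C.1 <;> by_cases hD : N D.1
  · simp only [f, dif_pos hC, dif_pos hD, Sum.inl.injEq, Subtype.mk.injEq] at hCD
    rw [← hC.choose_spec.1, ← hD.choose_spec.1, Subtype.ext hCD]
  · simp [f, dif_pos hC, dif_neg hD] at hCD
  · simp [f, dif_neg hC, dif_pos hD] at hCD
  · simp only [f, dif_neg hC, dif_neg hD, Sum.inr.injEq, Subtype.mk.injEq] at hCD
    obtain ⟨a, ha⟩ := C.1.exists_rep
    obtain ⟨x, hx, hxa⟩ := (map_eq_mk_iff G S T v D.1 (hN D.1 hD)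
      (delGraphEraseHom G S T v a)).1 (hCD ▸ ha ▸ rfl)
    rw [← hx, delGraphEraseHom_injective G S T v hxa]
    exact ha.symm

/-- Removing a vertex outside `X` from `T` does not increase `δ`. -/
theorem eulerDelta_erase_le {V : Type*} [Finite V] [DecidableEq V] (G : SimpleGraph V)
    (X S T : Finset V) {v : V} (hvT : v ∈ T) (hvX : v ∉ X) :
    eulerDelta G X S (T.erase v) ≤ eulerDelta G X S T := by
  have hTX : T.erase v ∩ X = T ∩ X := by
    rw [erase_inter, erase_eq_of_notMem fun h => hvX (mem_inter.1 h).2]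
  have hq := qST_le_degDel_add G S T v
  have hsum := add_sum_erase T (fun v => (degDel G S v : ℤ)) hvT
  unfold eulerDelta
  rw [hTX]
  lia

/-- **Lemma 2.3(i).** If `(S, T)` is a minimum barrier of a finite bipartite graph `G`
with parts `X`, `Y`, then `T ⊆ X`. -/
theorem minBarrier_T_subset_X {V : Type*} [Fintype V] [DecidableEq V] (G : SimpleGraph V)
    (X Y S T : Finset V)
    (hpart : X ∪ Y = Finset.univ) (hXY : Disjoint X Y)
    (hbip : ∀ u v, G.Adj u v → (u ∈ X ↔ v ∈ Y))
    (hmin : IsMinBarrier G X Y S T) :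
    T ⊆ X := by
  obtain ⟨⟨hSX, hT, hST, hδ⟩, hle⟩ := hmin
  intro v hvT
  by_contra hvX
  have hsub := erase_subset v T
  have hST' := hST.mono_right hsub
  have h := hle S (T.erase v) ⟨hSX, hsub.trans hT, hST',
    (eulerDelta_erase_le G X S T hvT hvX).trans_lt hδ⟩
  rw [card_union_of_disjoint hST, card_union_of_disjoint hST'] at h
  have := card_erase_lt_of_mem hvT
  lia
end

section
/- Let G be a bipartite graph with parts X and Y, let (S,T) be a minimum barrier of G, and let O_1,…,O_q be the T-odd components of G − (S ∪ T), where q = q(S,T). Then |T| − |S| > (1/2) · Σ_{i=1}^{q} (ε(T,O_i) − 1), where ε(T,O_i) is the number of edges of G with one endpoint in T and the other in O_i. -/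
open Finset SimpleGraph

attribute [local instance] Classical.propDecidable

/-- Edges from `T` to components of `G − (S ∪ T)` are counted by the degrees in `G − S`
of the vertices of `T`. -/
theorem sum_epsTC_le_sum_degDel {V : Type*} [Fintype V] [DecidableEq V] (G : SimpleGraph V)
    (S T : Finset V) (A : Finset (delGraph G (S ∪ T)).ConnectedComponent) :
    ∑ C ∈ A, epsTC G S T C ≤ ∑ v ∈ T, degDel G S v := by
  rw [← Finset.sum_coe_sort A, ← Finset.sum_coe_sort T]
  unfold epsTC degDel
  rw [← Nat.card_sigma, ← Nat.card_sigma]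
  refine Nat.card_le_card_of_injective
    (fun x => ⟨⟨x.2.1.1, x.2.2.1⟩, ⟨x.2.1.2.1, x.2.2.2.1,
      fun h => x.2.1.2.2 (Finset.mem_union_left _ h)⟩⟩) ?_
  rintro ⟨⟨C, hC⟩, ⟨⟨v, w⟩, hv, hvw, hwC⟩⟩ ⟨⟨D, hD⟩, ⟨⟨v', w'⟩, hv', hvw', hwD⟩⟩ h
  dsimp only at hwC hwD
  subst hwC hwD
  obtain ⟨w, hw⟩ := w
  obtain ⟨w', hw'⟩ := w'
  simp only [Sigma.mk.injEq, Subtype.mk.injEq] at h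
  obtain ⟨rfl, h⟩ := h
  obtain rfl : w = w' := by simpa using h
  rfl

/-- **Lemma 2.3(iv).** Let `(S, T)` be a minimum barrier of a finite bipartite graph `G`
with parts `X`, `Y`, and let `O_1, …, O_q` be the `T`-odd components of `G − (S ∪ T)`.
Then `|T| − |S| > (1/2) · Σ_{i=1}^{q} (ε_G(T, O_i) − 1)`. -/
theorem minBarrier_size {V : Type*} [Fintype V] [DecidableEq V] (G : SimpleGraph V)
    (X Y S T : Finset V)
    (hpart : X ∪ Y = Finset.univ) (hXY : Disjoint X Y)
    (hbip : ∀ u v, G.Adj u v → (u ∈ X ↔ v ∈ Y))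
    (hmin : IsMinBarrier G X Y S T) :
    (1 / 2 : ℚ) *
        ∑ C ∈ Finset.univ.filter
            (fun C : (delGraph G (S ∪ T)).ConnectedComponent => Odd (epsTC G S T C)),
          ((epsTC G S T C : ℚ) - 1) <
      (T.card : ℚ) - (S.card : ℚ) := by
  have hle := sum_epsTC_le_sum_degDel G S T (Finset.univ.filter
    (fun C : (delGraph G (S ∪ T)).ConnectedComponent => Odd (epsTC G S T C)))
  have hδ := hmin.1.2.2.2
  have hq : qST G S T = (Finset.univ.filter
      (fun C : (delGraph G (S ∪ T)).ConnectedComponent => Odd (epsTC G S T C))).card := by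
    rw [qST, Nat.card_eq_fintype_card, Fintype.card_subtype]
  have hT : (T ∩ X).card ≤ T.card := Finset.card_le_card Finset.inter_subset_left
  rw [eulerDelta, hq] at hδ
  rw [Finset.sum_sub_distrib, Finset.sum_const, nsmul_one]
  qify at hle hδ hT
  linarith
end

section
/- Let G be a simple bipartite graph with parts X and Y such that 3 ≤ c ≤ deg_G(x) ≤ k for every x ∈ X, and |N_G(y) ∩ N_G(z)| ≥ k for every pair of distinct vertices y,z ∈ Y. Then for every y ∈ Y, |N_G(y)| ≥ k(|Y|−1)/(k−1). -/
open Finset SimpleGraph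

/-- **Lemma 2.4(i).** Let `G` be a simple bipartite graph with parts `X`, `Y` such that
`3 ≤ c ≤ deg_G(x) ≤ k` for every `x ∈ X` and `|N_G(y) ∩ N_G(z)| ≥ k` for all distinct
`y, z ∈ Y`.  Then `|N_G(y)| ≥ k(|Y| − 1)/(k − 1)` for every `y ∈ Y`. -/
theorem neighbor_lower_bound {V : Type*} [Fintype V] [DecidableEq V] (G : SimpleGraph V)
    [DecidableRel G.Adj] (X Y : Finset V) (c k : ℕ)
    (hpart : X ∪ Y = Finset.univ) (hXY : Disjoint X Y)
    (hbip : ∀ u v, G.Adj u v → (u ∈ X ↔ v ∈ Y))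
    (hc : 3 ≤ c) (hck : c ≤ k)
    (hdegl : ∀ x ∈ X, c ≤ G.degree x) (hdegu : ∀ x ∈ X, G.degree x ≤ k)
    (hco : ∀ y ∈ Y, ∀ z ∈ Y, y ≠ z →
      k ≤ (G.neighborFinset y ∩ G.neighborFinset z).card) :
    ∀ y ∈ Y, (k : ℚ) * ((Y.card : ℚ) - 1) / ((k : ℚ) - 1) ≤
      ((G.neighborFinset y).card : ℚ) := by
  intro y hy
  have hcount : (Y.erase y).card * k ≤ (G.neighborFinset y).card * (k - 1) := by
    refine Finset.card_mul_le_card_mul G.Adj (fun z hz => ?_) (fun x hx => ?_)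
    · obtain ⟨hzy, hz⟩ := Finset.mem_erase.1 hz
      refine (hco y hy z hz hzy.symm).trans (Finset.card_le_card fun x hx => ?_)
      simpa [Finset.mem_bipartiteAbove] using hx
    · rw [mem_neighborFinset] at hx
      have hxX : x ∈ X := (hbip x y hx.symm).2 hy
      have hsub : (Y.erase y).bipartiteBelow G.Adj x ⊆ (G.neighborFinset x).erase y := by
        intro z hz
        simp only [Finset.mem_bipartiteBelow, Finset.mem_erase] at hz
        simpa [hz.1.1] using hz.2.symm
      have hle := Finset.card_le_card hsub
      rw [Finset.card_erase_of_mem ((G.mem_neighborFinset x y).2 hx.symm),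
        card_neighborFinset_eq_degree] at hle
      exact hle.trans (Nat.sub_le_sub_right (hdegu x hxX) 1)
  have hk : 3 ≤ k := hc.trans hck
  have hkQ : (3 : ℚ) ≤ k := by exact_mod_cast hk
  rw [Finset.card_erase_of_mem hy] at hcount
  have hcountQ : (((Y.card - 1) * k : ℕ) : ℚ) ≤
      (((G.neighborFinset y).card * (k - 1) : ℕ) : ℚ) := by exact_mod_cast hcount
  rw [Nat.cast_mul, Nat.cast_mul, Nat.cast_pred (Finset.card_pos.2 ⟨y, hy⟩),
    Nat.cast_pred (by lia)] at hcountQ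
  rw [div_le_iff₀ (by linarith), mul_comm (k : ℚ)]
  exact hcountQ
end

section
/- Let G be a simple bipartite graph with parts X and Y such that 3 ≤ c ≤ deg_G(x) ≤ k for every x ∈ X, and |N_G(y) ∩ N_G(z)| ≥ k for every pair of distinct vertices y,z ∈ Y. Then for every subset B ⊆ Y, |N_G(B) ∩ N_G(Y \ B)| ≥ 2|B|·(|Y|−|B|)/(k−1), where N_G(A) denotes the set of vertices having a neighbor in A. -/
open Finset SimpleGraph

/-- Double counting: if any vertex of `B` and any vertex of `C` have at least `k` common neighbors,
and every vertex with neighbors in both of the disjoint sets `B`, `C` has degree at most `k`, then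
at least `4|B||C| / k` vertices have neighbors in both. -/
theorem four_mul_card_mul_card_le {V : Type*} [Fintype V] [DecidableEq V]
    (G : SimpleGraph V) [DecidableRel G.Adj] {B C : Finset V} {k : ℕ} (hk : 0 < k)
    (hBC : Disjoint B C)
    (hdeg : ∀ x, ∀ y ∈ B, G.Adj y x → G.degree x ≤ k)
    (hco : ∀ y ∈ B, ∀ z ∈ C, k ≤ (G.neighborFinset y ∩ G.neighborFinset z).card) :
    4 * (B.card * C.card) ≤ k * ((B.biUnion fun y => G.neighborFinset y) ∩
      (C.biUnion fun y => G.neighborFinset y)).card := by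
  set S := (B.biUnion fun y => G.neighborFinset y) ∩
    (C.biUnion fun y => G.neighborFinset y) with hS
  have hcount := sum_card_bipartiteAbove_eq_sum_card_bipartiteBelow
    (s := B ×ˢ C) (t := S) (fun p x => G.Adj p.1 x ∧ G.Adj p.2 x)
  have hlow : (B.card * C.card) * k ≤
      ∑ p ∈ B ×ˢ C, (S.bipartiteAbove (fun p x => G.Adj p.1 x ∧ G.Adj p.2 x) p).card := by
    rw [← card_product, ← smul_eq_mul]
    refine card_nsmul_le_sum _ _ _ fun p hp => ?_
    obtain ⟨hp₁, hp₂⟩ := mem_product.mp hp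
    refine (hco _ hp₁ _ hp₂).trans (card_le_card fun x hx => ?_)
    simp only [mem_inter, mem_neighborFinset] at hx
    simp only [mem_bipartiteAbove, hS, mem_inter, mem_biUnion, mem_neighborFinset]
    exact ⟨⟨⟨_, hp₁, hx.1⟩, ⟨_, hp₂, hx.2⟩⟩, hx⟩
  have hup : ∀ x ∈ S,
      4 * ((B ×ˢ C).bipartiteBelow (fun p x => G.Adj p.1 x ∧ G.Adj p.2 x) x).card ≤ k * k := by
    intro x hx
    simp only [hS, mem_inter, mem_biUnion, mem_neighborFinset] at hx
    obtain ⟨⟨y, hy, hyx⟩, -⟩ := hx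
    have hsum : (B.filter (G.Adj · x)).card + (C.filter (G.Adj · x)).card ≤ k := by
      rw [← card_union_of_disjoint (disjoint_filter_filter hBC), ← filter_union]
      refine (card_le_card fun z hz => ?_).trans (hdeg x y hy hyx)
      exact (G.mem_neighborFinset x z).mpr (mem_filter.mp hz).2.symm
    have hprod : (B ×ˢ C).bipartiteBelow (fun p x => G.Adj p.1 x ∧ G.Adj p.2 x) x =
        B.filter (G.Adj · x) ×ˢ C.filter (G.Adj · x) :=
      filter_product (G.Adj · x) (G.Adj · x)
    rw [hprod, card_product, ← mul_assoc]
    exact (four_mul_le_sq_add _ _).trans (by rw [sq]; exact Nat.mul_le_mul hsum hsum)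
  have htotal := sum_le_card_nsmul _ _ _ hup
  rw [← mul_sum, ← hcount, smul_eq_mul] at htotal
  refine Nat.le_of_mul_le_mul_right ?_ hk
  linarith

/-- **Lemma 2.4(ii).** Let `G` be a simple bipartite graph with parts `X`, `Y` such that
`3 ≤ c ≤ deg_G(x) ≤ k` for every `x ∈ X` and `|N_G(y) ∩ N_G(z)| ≥ k` for all distinct
`y, z ∈ Y`.  Then for every `B ⊆ Y`,
`|N_G(B) ∩ N_G(Y \ B)| ≥ 2|B|(|Y| − |B|)/(k − 1)`, where `N_G(A)` denotes the set of
vertices having a neighbor in `A`. -/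
theorem common_neighborhood_lower_bound {V : Type*} [Fintype V] [DecidableEq V]
    (G : SimpleGraph V) [DecidableRel G.Adj] (X Y : Finset V) (c k : ℕ)
    (hpart : X ∪ Y = Finset.univ) (hXY : Disjoint X Y)
    (hbip : ∀ u v, G.Adj u v → (u ∈ X ↔ v ∈ Y))
    (hc : 3 ≤ c) (hck : c ≤ k)
    (hdegl : ∀ x ∈ X, c ≤ G.degree x) (hdegu : ∀ x ∈ X, G.degree x ≤ k)
    (hco : ∀ y ∈ Y, ∀ z ∈ Y, y ≠ z →
      k ≤ (G.neighborFinset y ∩ G.neighborFinset z).card) :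
    ∀ B ⊆ Y,
      2 * (B.card : ℚ) * ((Y.card : ℚ) - (B.card : ℚ)) / ((k : ℚ) - 1) ≤
        (((B.biUnion fun y => G.neighborFinset y) ∩
          ((Y \ B).biUnion fun y => G.neighborFinset y)).card : ℚ) := by
  intro B hB
  have hk : 3 ≤ k := hc.trans hck
  have hmain := four_mul_card_mul_card_le G (B := B) (C := Y \ B) (k := k) (by omega)
    disjoint_sdiff
    (fun x y hy hyx => hdegu x ((hbip x y hyx.symm).mpr (hB hy)))
    (fun y hy z hz => hco y (hB hy) z (mem_sdiff.mp hz).1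
      fun h => (mem_sdiff.mp hz).2 (h ▸ hy))
  have hcard : ((Y \ B).card : ℚ) = (Y.card : ℚ) - (B.card : ℚ) := cast_card_sdiff hB
  have hkq : (3 : ℚ) ≤ k := by exact_mod_cast hk
  rw [← hcard, div_le_iff₀ (by linarith)]
  have hmainq : 4 * ((B.card : ℚ) * ((Y \ B).card : ℚ)) ≤
      k * (((B.biUnion fun y => G.neighborFinset y) ∩
        ((Y \ B).biUnion fun y => G.neighborFinset y)).card : ℚ) := by
    exact_mod_cast hmain
  have hnonneg : (0 : ℚ) ≤ (((B.biUnion fun y => G.neighborFinset y) ∩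
      ((Y \ B).biUnion fun y => G.neighborFinset y)).card : ℚ) := Nat.cast_nonneg _
  nlinarith [mul_nonneg hnonneg (by linarith : (0 : ℚ) ≤ k - 2)]
end

section
/- Let G be a simple bipartite graph with parts X and Y such that 3 ≤ c ≤ deg_G(x) ≤ k for every x ∈ X, and |N_G(y) ∩ N_G(z)| ≥ k for every pair of distinct vertices y,z ∈ Y. Let μ = max_{u∈X} |{v ∈ X : N_G(u) = N_G(v)}|. If |Y| ≥ μ(k−1)(2^{k−c−1} − 2^c + 1), then G has a spanning tree F with deg_F(x) ≤ 2 for every x ∈ X. -/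
open Finset SimpleGraph

attribute [local instance] Classical.propDecidable

section PartitionConnected

variable {α β : Type*} [Fintype α]

/-- The hyperedges of `N` on which some function in `A` is not constant. -/
noncomputable def crossing (N : α → Finset β) (A : Submodule ℚ (β → ℚ)) : Finset α :=
  univ.filter fun a => ∃ f ∈ A, ∃ y ∈ N a, ∃ z ∈ N a, f y ≠ f z

/-- A linear form of partition-connectedness of the hypergraph `N`: a partition of `β` is
replaced by a space of functions on `β`, and its number of classes by the dimension. -/
def PartitionConnected (N : α → Finset β) : Prop :=
  ∀ A : Submodule ℚ (β → ℚ), Module.finrank ℚ A ≤ (crossing N A).card + 1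

lemma mem_crossing {N : α → Finset β} {A : Submodule ℚ (β → ℚ)} {a : α} :
    a ∈ crossing N A ↔ ∃ f ∈ A, ∃ y ∈ N a, ∃ z ∈ N a, f y ≠ f z := by
  simp [crossing]

/-- If any two vertices lie in at least `k` common hyperedges, and hyperedges have size at most
`k`, then at least `#R - 1` hyperedges contain two elements of `R`. -/
lemma card_le_card_hyperedges_add_one (N : α → Finset β) (k : ℕ) (hk : 0 < k)
    (hN : ∀ a, (N a).card ≤ k)
    (hco : ∀ y z, y ≠ z → k ≤ (univ.filter fun a => y ∈ N a ∧ z ∈ N a).card) (R : Finset β) :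
    R.card ≤ (univ.filter fun a => (N a ∩ R).offDiag.Nonempty).card + 1 := by
  set S := univ.filter fun a => (N a ∩ R).offDiag.Nonempty with hS
  rcases R.eq_empty_or_nonempty with rfl | hR
  · simp
  have hp : 0 < R.card := hR.card_pos
  have hlow : R.offDiag.card * k ≤ ∑ q ∈ R.offDiag,
      (univ.filter fun a => q.1 ∈ N a ∧ q.2 ∈ N a).card := by
    rw [← smul_eq_mul]
    refine card_nsmul_le_sum _ _ _ fun q hq => hco _ _ (mem_offDiag.1 hq).2.2
  have hswap : ∑ q ∈ R.offDiag, (univ.filter fun a => q.1 ∈ N a ∧ q.2 ∈ N a).card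
      = ∑ a, (N a ∩ R).offDiag.card := by
    simp_rw [card_filter]
    rw [sum_comm]
    refine sum_congr rfl fun a _ => ?_
    rw [← card_filter]
    congr 1
    ext q
    simp only [mem_filter, mem_offDiag, mem_inter]
    tauto
  have hsupp : ∑ a, (N a ∩ R).offDiag.card = ∑ a ∈ S, (N a ∩ R).offDiag.card := by
    symm
    refine sum_subset (subset_univ _) fun a _ ha => ?_
    rw [card_eq_zero, ← not_nonempty_iff_eq_empty]
    simpa only [hS, mem_filter, mem_univ, true_and] using ha
  have hup : ∑ a ∈ S, (N a ∩ R).offDiag.card ≤ S.card * (k * R.card) := by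
    rw [← smul_eq_mul]
    refine sum_le_card_nsmul _ _ _ fun a _ => ?_
    have h1 : (N a ∩ R).card ≤ k := (card_le_card inter_subset_left).trans (hN a)
    have h2 : (N a ∩ R).card ≤ R.card := card_le_card inter_subset_right
    rw [offDiag_card]
    exact (Nat.sub_le _ _).trans (Nat.mul_le_mul h1 h2)
  have key : (k * R.card) * (R.card - 1) ≤ (k * R.card) * S.card := by
    calc (k * R.card) * (R.card - 1) = R.offDiag.card * k := by
          rw [offDiag_card, ← Nat.mul_sub_one]; ring
      _ ≤ S.card * (k * R.card) := by omega
      _ = _ := mul_comm _ _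
  have := Nat.le_of_mul_le_mul_left key (by positivity)
  omega

lemma partitionConnected_of_common [Fintype β] (N : α → Finset β) (k : ℕ) (hk : 0 < k)
    (hN : ∀ a, (N a).card ≤ k)
    (hco : ∀ y z, y ≠ z → k ≤ (univ.filter fun a => y ∈ N a ∧ z ∈ N a).card) :
    PartitionConnected N := by
  intro A
  let s : Setoid β :=
    { r := fun y z => ∀ f ∈ A, f y = f z
      iseqv := ⟨fun _ _ _ => rfl, fun h f hf => (h f hf).symm,
        fun h h' f hf => (h f hf).trans (h' f hf)⟩ }
  let R : Finset β := univ.image (Quotient.out : Quotient s → β)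
  let φ : A →ₗ[ℚ] (R → ℚ) := (LinearMap.funLeft ℚ ℚ (Subtype.val : R → β)).comp A.subtype
  have hφ : Function.Injective φ := by
    intro f g hfg
    ext y
    have hy : (⟦y⟧ : Quotient s).out ∈ R := mem_image_of_mem _ (mem_univ _)
    have h : ∀ f ∈ A, f (⟦y⟧ : Quotient s).out = f y := Quotient.mk_out (s := s) y
    have := congrFun hfg ⟨_, hy⟩
    rw [← h f f.2, ← h g g.2]
    exact this
  have hdim : Module.finrank ℚ A ≤ R.card := by
    simpa using LinearMap.finrank_le_finrank_of_injective hφ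
  refine (hdim.trans (card_le_card_hyperedges_add_one N k hk hN hco R)).trans
    (Nat.add_le_add_right (card_le_card fun a ha => ?_) 1)
  obtain ⟨⟨y, z⟩, hyz⟩ := (mem_filter.1 ha).2
  simp only [mem_offDiag, mem_inter] at hyz
  obtain ⟨⟨hy, hyR⟩, ⟨hz, hzR⟩, hne⟩ := hyz
  rw [mem_crossing]
  by_contra! hcon
  obtain ⟨q, -, rfl⟩ := mem_image.1 hyR
  obtain ⟨q', -, rfl⟩ := mem_image.1 hzR
  refine hne (congrArg _ (Quotient.out_equiv_out.1 ?_))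
  exact fun f hf => hcon f hf _ hy _ hz

lemma PartitionConnected.exists_tight {N : α → Finset β} (hN : PartitionConnected N) {a : α}
    {b : β} (h : ¬ PartitionConnected (Function.update N a ((N a).erase b))) :
    ∃ A : Submodule ℚ (β → ℚ), Module.finrank ℚ A = (crossing N A).card + 1 ∧
      a ∈ crossing N A ∧ ∀ f ∈ A, ∀ y ∈ (N a).erase b, ∀ z ∈ (N a).erase b, f y = f z := by
  simp only [PartitionConnected, not_forall, not_le] at h
  obtain ⟨A, hA⟩ := h
  have hle := hN A
  set N' := Function.update N a ((N a).erase b) with hN'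
  have hsub : (crossing N A).erase a ⊆ crossing N' A := by
    intro x hx
    obtain ⟨hxa, hx⟩ := mem_erase.1 hx
    rw [mem_crossing] at hx ⊢
    rwa [hN', Function.update_of_ne hxa]
  have hcard := card_le_card hsub
  have ha : a ∈ crossing N A := by
    by_contra ha
    rw [erase_eq_of_notMem ha] at hcard
    omega
  have hna : a ∉ crossing N' A := by
    intro hna
    have : crossing N A ⊆ crossing N' A := by
      intro x hx
      by_cases hxa : x = a
      · exact hxa ▸ hna
      · exact hsub (mem_erase.2 ⟨hxa, hx⟩)
    have := card_le_card this
    omega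
  rw [card_erase_of_mem ha] at hcard
  refine ⟨A, by omega, ha, ?_⟩
  rw [mem_crossing, hN', Function.update_self] at hna
  push Not at hna
  exact hna

lemma PartitionConnected.exists_erase [Fintype β] {N : α → Finset β} (hN : PartitionConnected N) {a : α}
    (ha : 2 < (N a).card) :
    ∃ b ∈ N a, PartitionConnected (Function.update N a ((N a).erase b)) := by
  by_contra! hcon
  obtain ⟨b, c, d, hb, hc, hd, hbc, hbd, hcd⟩ := two_lt_card_iff.1 ha
  obtain ⟨A, hA, haA, hAf⟩ := hN.exists_tight (hcon b hb)
  obtain ⟨B, hB, haB, hBf⟩ := hN.exists_tight (hcon c hc)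
  have hmod := Submodule.finrank_sup_add_finrank_inf_eq A B
  have hsup := hN (A ⊔ B)
  have hinf := hN (A ⊓ B)
  have h1 : crossing N (A ⊔ B) ⊆ crossing N A ∪ crossing N B := by
    intro x hx
    rw [mem_crossing] at hx
    obtain ⟨f, hf, y, hy, z, hz, hne⟩ := hx
    obtain ⟨g, hg, h, hh, rfl⟩ := Submodule.mem_sup.1 hf
    rw [mem_union, mem_crossing, mem_crossing]
    by_contra! hno
    exact hne (congrArg₂ (· + ·) (hno.1 g hg y hy z hz) (hno.2 h hh y hy z hz))
  have h2 : crossing N (A ⊓ B) ⊆ (crossing N A ∩ crossing N B).erase a := by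
    intro x hx
    rw [mem_crossing] at hx
    obtain ⟨f, hf, y, hy, z, hz, hne⟩ := hx
    refine mem_erase.2 ⟨?_, mem_inter.2 ⟨mem_crossing.2 ⟨f, hf.1, y, hy, z, hz, hne⟩,
      mem_crossing.2 ⟨f, hf.2, y, hy, z, hz, hne⟩⟩⟩
    rintro rfl
    have hconst : ∀ y ∈ N x, f y = f d := by
      intro y hy
      by_cases hyb : y = b
      · exact hBf f hf.2 y (mem_erase.2 ⟨hyb ▸ hbc, hy⟩) d (mem_erase.2 ⟨hcd.symm, hd⟩)
      · exact hAf f hf.1 y (mem_erase.2 ⟨hyb, hy⟩) d (mem_erase.2 ⟨hbd.symm, hd⟩)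
    exact hne ((hconst y hy).trans (hconst z hz).symm)
  have haAB : a ∈ crossing N A ∩ crossing N B := mem_inter.2 ⟨haA, haB⟩
  have h1c := card_le_card h1
  have h2c := card_le_card h2
  rw [card_erase_of_mem haAB] at h2c
  have hpos := card_pos.2 ⟨a, haAB⟩
  have := card_union_add_card_inter (crossing N A) (crossing N B)
  omega

/-- A partition-connected hypergraph can be trimmed to a partition-connected graph. -/
lemma PartitionConnected.exists_trim [Fintype β] {N : α → Finset β} (hN : PartitionConnected N)
    (hne : ∀ a, (N a).Nonempty) :
    ∃ M : α → Finset β, (∀ a, M a ⊆ N a) ∧ (∀ a, (M a).Nonempty) ∧ (∀ a, (M a).card ≤ 2) ∧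
      PartitionConnected M := by
  induction hn : ∑ a, (N a).card using Nat.strong_induction_on generalizing N with
  | _ n ih =>
    by_cases hle : ∀ a, (N a).card ≤ 2
    · exact ⟨N, fun _ => Subset.rfl, hne, hle, hN⟩
    push Not at hle
    obtain ⟨a, ha⟩ := hle
    obtain ⟨b, hb, hM⟩ := hN.exists_erase ha
    have hcard := card_erase_of_mem hb
    have hsub : ∀ x, Function.update N a ((N a).erase b) x ⊆ N x := by
      intro x
      by_cases hx : x = a
      · subst hx; simpa using erase_subset _ _
      · simp [hx]
    obtain ⟨M, hMN, h⟩ := ih _ (by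
      rw [← hn]
      refine sum_lt_sum (fun x _ => card_le_card (hsub x)) ⟨a, mem_univ _, ?_⟩
      simp only [Function.update_self]
      omega) hM (by
      intro x
      by_cases hx : x = a
      · subst hx
        rw [Function.update_self, ← card_pos]
        omega
      · simpa [hx] using hne x) rfl
    exact ⟨M, fun x => (hMN x).trans (hsub x), h⟩

lemma PartitionConnected.eq_of_forall [Fintype β] {N : α → Finset β} (hN : PartitionConnected N)
    {f : β → ℚ} (hf : ∀ a, ∀ y ∈ N a, ∀ z ∈ N a, f y = f z) (y z : β) : f y = f z := by
  let A : Submodule ℚ (β → ℚ) :=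
    { carrier := {f | ∀ a, ∀ y ∈ N a, ∀ z ∈ N a, f y = f z}
      add_mem' := fun hf hg a y hy z hz =>
        congrArg₂ (· + ·) (hf a y hy z hz) (hg a y hy z hz)
      zero_mem' := fun _ _ _ _ _ => rfl
      smul_mem' := fun c _ hf a y hy z hz => congrArg (c * ·) (hf a y hy z hz) }
  have hA : crossing N A = ∅ := by
    refine eq_empty_of_forall_notMem fun a ha => ?_
    obtain ⟨g, hg, y, hy, z, hz, hne⟩ := mem_crossing.1 ha
    exact hne (hg a y hy z hz)
  have hdim := hN A
  rw [hA, card_empty, zero_add, finrank_le_one_iff] at hdim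
  obtain ⟨v, hv⟩ := hdim
  obtain ⟨s, hs⟩ := hv ⟨f, hf⟩
  obtain ⟨t, ht⟩ := hv ⟨fun _ => 1, fun _ _ _ _ _ => rfl⟩
  have hs' : ∀ w, s * v.1 w = f w := fun w => congrFun (congrArg Subtype.val hs) w
  have ht' : ∀ w, t * v.1 w = 1 := fun w => congrFun (congrArg Subtype.val ht) w
  have ht0 : t ≠ 0 := fun h => by simpa [h] using ht' y
  have : v.1 y = v.1 z := mul_left_cancel₀ ht0 ((ht' y).trans (ht' z).symm)
  rw [← hs', ← hs', this]

end PartitionConnected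

/-- **Lemma 2.4(iii).** Let `G` be a nonempty simple bipartite graph with parts `X`, `Y`
such that `3 ≤ c ≤ deg_G(x) ≤ k` for every `x ∈ X` and `|N_G(y) ∩ N_G(z)| ≥ k` for all
distinct `y, z ∈ Y`.  Let `μ = max_{u ∈ X} |{v ∈ X : N_G(u) = N_G(v)}|`.  If
`|Y| ≥ μ(k−1)(2^(k−c−1) − 2^c + 1)`, then `G` has a spanning tree `F` with
`deg_F(x) ≤ 2` for every `x ∈ X`. -/
theorem exists_nice_spanning_tree {V : Type*} [Fintype V] [DecidableEq V] [Nonempty V]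
    (G : SimpleGraph V) [DecidableRel G.Adj] (X Y : Finset V) (c k : ℕ)
    (hpart : X ∪ Y = Finset.univ) (hXY : Disjoint X Y)
    (hbip : ∀ u v, G.Adj u v → (u ∈ X ↔ v ∈ Y))
    (hc : 3 ≤ c) (hck : c ≤ k)
    (hdegl : ∀ x ∈ X, c ≤ G.degree x) (hdegu : ∀ x ∈ X, G.degree x ≤ k)
    (hco : ∀ y ∈ Y, ∀ z ∈ Y, y ≠ z →
      k ≤ (G.neighborFinset y ∩ G.neighborFinset z).card)
    (hY : ((X.sup fun u =>
        (X.filter fun v => G.neighborFinset u = G.neighborFinset v).card : ℕ) : ℤ) *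
          ((k : ℤ) - 1) * ((2 : ℤ) ^ (k - c - 1) - 2 ^ c + 1) ≤ (Y.card : ℤ)) :
    ∃ F : SimpleGraph V, F ≤ G ∧ F.IsTree ∧ ∀ x ∈ X, F.degree x ≤ 2 := by
  have hYX : ∀ v, v ∉ X → v ∈ Y := fun v hv =>
    (mem_union.1 (hpart ▸ mem_univ v)).resolve_left hv
  have hnotX : ∀ v ∈ Y, v ∉ X := fun v hv hx => (Finset.disjoint_left.1 hXY) hx hv
  let N : X → Finset Y := fun x => univ.filter fun y => G.Adj x y
  have hNmap : ∀ x : X, (N x).map (Function.Embedding.subtype _) = G.neighborFinset x := by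
    intro x
    ext v
    simp only [N, mem_map, mem_filter, mem_univ, true_and, mem_neighborFinset]
    constructor
    · rintro ⟨y, hy, rfl⟩
      exact hy
    · intro h
      exact ⟨⟨v, (hbip _ _ h).1 x.2⟩, h, rfl⟩
  have hNcard : ∀ x : X, (N x).card = G.degree x := by
    intro x
    rw [← card_neighborFinset_eq_degree, ← hNmap x, card_map]
  have hN : PartitionConnected N := by
    refine partitionConnected_of_common N k (by omega)
      (fun x => (hNcard x).trans_le (hdegu x x.2)) fun y z hyz => ?_
    refine (hco y y.2 z z.2 (fun h => hyz (Subtype.ext h))).trans ?_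
    rw [← card_map (Function.Embedding.subtype (· ∈ X))]
    refine card_le_card fun v hv => ?_
    simp only [mem_inter, mem_neighborFinset] at hv
    have hvX : v ∈ X := (hbip _ _ hv.1.symm).2 y.2
    exact mem_map.2 ⟨⟨v, hvX⟩, by simp [N, hv.1.symm, hv.2.symm], rfl⟩
  obtain ⟨M, hMN, hMne, hM2, hM⟩ := hN.exists_trim fun x => by
    rw [← card_pos, hNcard]
    have := hdegl x x.2
    omega
  let H : SimpleGraph V :=
    { Adj := fun u v => (∃ (x : X) (y : Y), y ∈ M x ∧ u = x ∧ v = y) ∨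
        ∃ (x : X) (y : Y), y ∈ M x ∧ v = x ∧ u = y
      symm := ⟨fun _ _ h => h.symm⟩
      loopless := ⟨fun u h => by
        rcases h with ⟨x, y, -, rfl, h⟩ | ⟨x, y, -, rfl, h⟩ <;>
          exact hnotX _ y.2 (h ▸ x.2)⟩ }
  have hHadj : ∀ (x : X) (y : Y), y ∈ M x → H.Adj x y := fun x y h =>
    Or.inl ⟨x, y, h, rfl, rfl⟩
  have hHG : H ≤ G := by
    have hG : ∀ (x : X) (y : Y), y ∈ M x → G.Adj x y := fun x y h =>
      (mem_filter.1 (hMN x h)).2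
    rintro u v (⟨x, y, h, rfl, rfl⟩ | ⟨x, y, h, rfl, rfl⟩)
    · exact hG x y h
    · exact (hG x y h).symm
  have hreachY : ∀ y z : Y, H.Reachable y z := by
    intro y z
    have := hM.eq_of_forall (f := fun w => if H.Reachable y w then 1 else 0) (by
      intro x u hu v hv
      have huv : H.Reachable u v :=
        (hHadj x u hu).symm.reachable.trans (hHadj x v hv).reachable
      have : H.Reachable y u ↔ H.Reachable y v :=
        ⟨fun h => h.trans huv, fun h => h.trans huv.symm⟩
      simp only [this]) y z
    by_contra hz
    simp [hz] at this
  have hreach : ∀ v : V, ∃ y : Y, H.Reachable v y := by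
    intro v
    by_cases hv : v ∈ X
    · obtain ⟨y, hy⟩ := hMne ⟨v, hv⟩
      exact ⟨y, (hHadj ⟨v, hv⟩ y hy).reachable⟩
    · exact ⟨⟨v, hYX v hv⟩, Reachable.refl _⟩
  have hconn : H.Connected := by
    refine ⟨fun u v => ?_⟩
    obtain ⟨y, hy⟩ := hreach u
    obtain ⟨z, hz⟩ := hreach v
    exact hy.trans ((hreachY y z).trans hz.symm)
  obtain ⟨F, hFH, hF⟩ := hconn.exists_isTree_le
  refine ⟨F, hFH.trans hHG, hF, fun x hx => ?_⟩
  rw [← card_neighborFinset_eq_degree]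
  refine le_trans ?_ (hM2 ⟨x, hx⟩)
  rw [← card_map (Function.Embedding.subtype (· ∈ Y))]
  refine card_le_card fun v hv => ?_
  rcases hFH ((mem_neighborFinset _ _ _).1 hv) with ⟨x', y, h, rfl, rfl⟩ | ⟨x', y, -, -, rfl⟩
  · exact mem_map.2 ⟨y, h, rfl⟩
  · exact absurd hx (hnotX _ y.2)
end

section
/- Let r, k, n be integers with 3 ≤ r ≤ k ≤ n. If either (r = 3 and n > k² − 3k + 4) or (r ≥ 4 and n ≥ C(k,2)+1), then C(n−2, r−2) > (k−1) · C(k−2, r−2). -/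
/-- The ratio `C(m, s) / C(a, s)` does not decrease in `s ≤ a` when `a ≤ m`, so a lower bound
for it at one value of `s` persists. -/
theorem Nat.mul_choose_lt_choose_of_le {c a m s t : ℕ} (ham : a ≤ m) (hst : s ≤ t) (hta : t ≤ a)
    (h : c * a.choose s < m.choose s) : c * a.choose t < m.choose t := by
  induction t, hst using Nat.le_induction with
  | base => exact h
  | succ t _ ih =>
    refine lt_of_mul_lt_mul_right (a := t + 1) ?_ (Nat.zero_le _)
    rw [mul_assoc, Nat.choose_succ_right_eq, Nat.choose_succ_right_eq, ← mul_assoc]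
    exact Nat.mul_lt_mul_of_lt_of_le (ih (by omega)) (by omega) (by omega)

/-- **Section 4.4.** Let `r`, `k`, `n` be integers with `3 ≤ r ≤ k ≤ n`.  If either
`r = 3` and `n > k² − 3k + 4`, or `r ≥ 4` and `n ≥ C(k,2) + 1`, then
`C(n − 2, r − 2) > (k − 1) · C(k − 2, r − 2)`. -/
theorem choose_ratio_bound (r k n : ℕ) (hr : 3 ≤ r) (hrk : r ≤ k) (hkn : k ≤ n)
    (h : (r = 3 ∧ k ^ 2 - 3 * k + 4 < n) ∨ (4 ≤ r ∧ k.choose 2 + 1 ≤ n)) :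
    (k - 1) * (k - 2).choose (r - 2) < (n - 2).choose (r - 2) := by
  obtain ⟨a, rfl⟩ := Nat.exists_eq_add_of_le' (show 2 ≤ k by omega)
  obtain ⟨m, rfl⟩ := Nat.exists_eq_add_of_le' (show 2 ≤ n by omega)
  simp only [Nat.add_sub_cancel, show a + 2 - 1 = a + 1 by omega]
  rcases h with ⟨rfl, h⟩ | ⟨hr4, h⟩
  · have hsq : (a + 2) ^ 2 - 3 * (a + 2) + 4 = (a + 1) * a + 2 := by
      have : (a + 2) ^ 2 + 2 = (a + 1) * a + 3 * (a + 2) := by ring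
      have : 3 * (a + 2) ≤ (a + 2) ^ 2 := by nlinarith
      omega
    simp only [Nat.choose_one_right, Nat.reduceSub]
    omega
  · refine Nat.mul_choose_lt_choose_of_le (s := 2) (by omega) (by omega) (by omega) ?_
    have hk := Nat.choose_succ_right_eq (a + 2) 1
    have ha := Nat.choose_succ_right_eq a 1
    have hm := Nat.choose_succ_right_eq m 1
    obtain ⟨b, rfl⟩ := Nat.exists_eq_add_of_le' (show 2 ≤ a by omega)
    obtain ⟨l, rfl⟩ := Nat.exists_eq_add_of_le' (show 1 ≤ m by omega)
    simp only [Nat.choose_one_right, Nat.reduceAdd, Nat.add_sub_cancel,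
      show b + 2 - 1 = b + 1 by omega, show b + 2 + 2 - 1 = b + 3 by omega] at hk ha hm
    have hl : (b + 1) * (b + 6) + 2 ≤ 2 * l := by nlinarith
    have hlt : (b + 3) * ((b + 2) * (b + 1)) < (l + 1) * l := by
      have hlin : 3 * b + 4 ≤ l := by nlinarith
      have := Nat.mul_le_mul hl hlin
      nlinarith
    nlinarith
end
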